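/- arXiv:2105.12520 — 3 statements merged into one kernel-verified Lean document; each statement's English description precedes it below -/
import Mathlib

section
/- Let q be a prime power and n, k, m positive integers with k | m and m | n. Let γ ∈ F_{q^m}^* be a root of an irreducible polynomial of degree m/k over F_{q^k}, where m/k > 4, and let ξ ∈ F_{q^n}^* be a root of an irreducible polynomial of degree n/m over F_{q^m}, where n/m > 2. Let δ_1, δ_2, τ_1, τ_2 ∈ F_{q^k}^*. Then U = {δ_1 a + δ_2 a^q ξ + τ_1 u γ + τ_2 u^q γ^2 : a, u ∈ F_{q^k}} is a Sidon space of F_q-dimension 2k. -/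
open Submodule Pointwise

set_option maxHeartbeats 1000000
set_option synthInstance.maxHeartbeats 400000

/-- An `F`-subspace `V` of a field `K` is a *Sidon space* if for all nonzero
`a, b, c, d ∈ V` with `a * b = c * d` one has `{aF, bF} = {cF, dF}` (as a pair of
one-dimensional `F`-subspaces). -/
def IsSidonSpace {K : Type*} [Field K] (F : Subfield K) (V : Submodule F K) : Prop :=
  ∀ a ∈ V, ∀ b ∈ V, ∀ c ∈ V, ∀ d ∈ V,
    a ≠ 0 → b ≠ 0 → c ≠ 0 → d ≠ 0 → a * b = c * d →
    ({Submodule.span F {a}, Submodule.span F {b}} : Set (Submodule F K)) =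
      {Submodule.span F {c}, Submodule.span F {d}}

/-- Two pairs with equal product and equal mixed product `a₁a₂^q + a₂a₁^q` agree up to a
scalar fixed by `x ↦ x ^ q`. -/
theorem exists_pow_eq_self_mul_of_mul_eq {K : Type*} [Field K] {q : ℕ} {a₁ a₂ a₃ a₄ : K}
    (h₁ : a₁ ≠ 0) (h₃ : a₃ ≠ 0) (h₄ : a₄ ≠ 0) (h : a₁ * a₂ = a₃ * a₄)
    (h' : a₁ * a₂ ^ q + a₂ * a₁ ^ q = a₃ * a₄ ^ q + a₄ * a₃ ^ q) :
    ∃ c : K, c ≠ 0 ∧ c ^ q = c ∧ (a₁ = c * a₃ ∨ a₁ = c * a₄) := by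
  have hq : a₁ ^ q * a₂ ^ q = a₃ ^ q * a₄ ^ q := by rw [← mul_pow, ← mul_pow, h]
  have key : (a₁ ^ q * a₃ - a₁ * a₃ ^ q) * (a₁ ^ q * a₄ - a₁ * a₄ ^ q) = 0 := by
    linear_combination (-(a₁ ^ q) ^ 2) * h - a₁ ^ 2 * hq + a₁ * a₁ ^ q * h'
  rcases mul_eq_zero.mp key with e | e
  · refine ⟨a₁ / a₃, div_ne_zero h₁ h₃, ?_, Or.inl (by field_simp)⟩
    rw [div_pow, div_eq_div_iff (pow_ne_zero _ h₃) h₃]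
    linear_combination e
  · refine ⟨a₁ / a₄, div_ne_zero h₁ h₄, ?_, Or.inr (by field_simp)⟩
    rw [div_pow, div_eq_div_iff (pow_ne_zero _ h₄) h₄]
    linear_combination e

/-- If `a₁` is a fixed scalar multiple of `a₃`, both nonzero, then the coefficient identities
force `(a₁, u₁)` to be proportional to `(a₃, u₃)` or `(a₄, u₄)`. -/
theorem exists_pow_eq_self_mul_pair_of_eq_mul {K : Type*} [Field K] {q : ℕ}
    {a₁ a₂ a₃ a₄ u₁ u₂ u₃ u₄ c : K} (h₂ : a₂ ≠ 0) (h₃ : a₃ ≠ 0)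
    (hc : c ≠ 0) (hcq : c ^ q = c) (hac : a₁ = c * a₃)
    (ha : a₁ * a₂ = a₃ * a₄) (hu : u₁ * u₂ = u₃ * u₄)
    (hau : a₁ * u₂ + a₂ * u₁ = a₃ * u₄ + a₄ * u₃)
    (hauq : a₁ ^ q * u₂ + a₂ ^ q * u₁ = a₃ ^ q * u₄ + a₄ ^ q * u₃) :
    ∃ c : K, c ≠ 0 ∧ c ^ q = c ∧
      ((a₁ = c * a₃ ∧ u₁ = c * u₃) ∨ (a₁ = c * a₄ ∧ u₁ = c * u₄)) := by
  subst hac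
  obtain rfl : a₄ = c * a₂ := mul_left_cancel₀ h₃ (by linear_combination -ha)
  simp only [mul_pow, hcq] at hauq
  by_cases hu₁ : u₁ = c * u₃
  · exact ⟨c, hc, hcq, Or.inl ⟨rfl, hu₁⟩⟩
  have key : (a₃ ^ q * a₂ - a₃ * a₂ ^ q) * (u₁ - c * u₃) = 0 := by
    linear_combination a₃ ^ q * hau - a₃ * hauq
  have e : a₃ ^ q * a₂ - a₃ * a₂ ^ q = 0 :=
    (mul_eq_zero.mp key).resolve_right (sub_ne_zero.mpr hu₁)
  refine ⟨a₃ / a₂, div_ne_zero h₃ h₂, ?_, Or.inr ⟨by field_simp, ?_⟩⟩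
  · rw [div_pow, div_eq_div_iff (pow_ne_zero _ h₂) h₂]
    linear_combination e
  · have e' : (u₁ - c * u₃) * (a₂ * u₁ - a₃ * u₄) = 0 := by
      linear_combination u₁ * hau - c * a₃ * hu
    rw [div_mul_eq_mul_div, eq_div_iff h₂]
    linear_combination (mul_eq_zero.mp e').resolve_left (sub_ne_zero.mpr hu₁)

/-- If `a₁ = a₃ = 0`, the coefficient identities force `(a₁, u₁)` to be proportional to
`(a₃, u₃)` or `(a₄, u₄)`. -/
theorem exists_pow_eq_self_mul_pair_of_eq_zero {K : Type*} [Field K] {q : ℕ} (hq : q ≠ 0)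
    {a₁ a₂ a₃ a₄ u₁ u₂ u₃ u₄ : K} (ha₁ : a₁ = 0) (ha₃ : a₃ = 0)
    (h₁ : u₁ ≠ 0) (h₃ : u₃ ≠ 0) (h₄ : a₄ ≠ 0 ∨ u₄ ≠ 0)
    (hu : u₁ * u₂ = u₃ * u₄)
    (hau : a₁ * u₂ + a₂ * u₁ = a₃ * u₄ + a₄ * u₃)
    (hauq : a₁ ^ q * u₂ + a₂ ^ q * u₁ = a₃ ^ q * u₄ + a₄ ^ q * u₃)
    (huq : u₁ * u₂ ^ q + u₂ * u₁ ^ q = u₃ * u₄ ^ q + u₄ * u₃ ^ q) :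
    ∃ c : K, c ≠ 0 ∧ c ^ q = c ∧
      ((a₁ = c * a₃ ∧ u₁ = c * u₃) ∨ (a₁ = c * a₄ ∧ u₁ = c * u₄)) := by
  subst ha₁ ha₃
  simp only [zero_pow hq, zero_mul, zero_add] at hau hauq
  by_cases ha₄ : a₄ = 0
  · subst ha₄
    obtain ⟨c, hc, hcq, h⟩ :=
      exists_pow_eq_self_mul_of_mul_eq h₁ h₃ (h₄.resolve_left (by simp)) hu huq
    exact ⟨c, hc, hcq, by simpa using h⟩
  · have ha₂ : a₂ ≠ 0 := by
      rintro rfl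
      exact mul_ne_zero ha₄ h₃ (by linear_combination -hau)
    refine ⟨a₄ / a₂, div_ne_zero ha₄ ha₂, ?_, Or.inl ⟨by simp, ?_⟩⟩
    · rw [div_pow, div_eq_div_iff (pow_ne_zero _ ha₂) ha₂]
      refine mul_right_cancel₀ (mul_ne_zero h₁ h₃) ?_
      linear_combination a₄ ^ q * u₃ * hau - a₄ * u₃ * hauq
    · rw [div_mul_eq_mul_div, eq_div_iff ha₂]
      linear_combination hau

/-- The coefficient identities of `(a₁, u₁)(a₂, u₂) = (a₃, u₃)(a₄, u₄)` force `(a₁, u₁)` to be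
proportional to `(a₃, u₃)` or `(a₄, u₄)`, with a factor fixed by `x ↦ x ^ q`. -/
theorem exists_pow_eq_self_mul_pair {K : Type*} [Field K] {q : ℕ} (hq : q ≠ 0)
    {a₁ a₂ a₃ a₄ u₁ u₂ u₃ u₄ : K}
    (h₁ : a₁ ≠ 0 ∨ u₁ ≠ 0) (h₂ : a₂ ≠ 0 ∨ u₂ ≠ 0) (h₃ : a₃ ≠ 0 ∨ u₃ ≠ 0) (h₄ : a₄ ≠ 0 ∨ u₄ ≠ 0)
    (ha : a₁ * a₂ = a₃ * a₄) (hu : u₁ * u₂ = u₃ * u₄)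
    (haq : a₁ * a₂ ^ q + a₂ * a₁ ^ q = a₃ * a₄ ^ q + a₄ * a₃ ^ q)
    (hau : a₁ * u₂ + a₂ * u₁ = a₃ * u₄ + a₄ * u₃)
    (hauq : a₁ ^ q * u₂ + a₂ ^ q * u₁ = a₃ ^ q * u₄ + a₄ ^ q * u₃)
    (huq : u₁ * u₂ ^ q + u₂ * u₁ ^ q = u₃ * u₄ ^ q + u₄ * u₃ ^ q) :
    ∃ c : K, c ≠ 0 ∧ c ^ q = c ∧
      ((a₁ = c * a₃ ∧ u₁ = c * u₃) ∨ (a₁ = c * a₄ ∧ u₁ = c * u₄) ∨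
        (a₂ = c * a₃ ∧ u₂ = c * u₃) ∨ (a₂ = c * a₄ ∧ u₂ = c * u₄)) := by
  by_cases h0 : a₃ * a₄ = 0
  · have one {a₁ a₂ u₁ u₂ : K} (h₁ : a₁ ≠ 0 ∨ u₁ ≠ 0) (h10 : a₁ = 0)
        (hu : u₁ * u₂ = u₃ * u₄)
        (hau : a₁ * u₂ + a₂ * u₁ = a₃ * u₄ + a₄ * u₃)
        (hauq : a₁ ^ q * u₂ + a₂ ^ q * u₁ = a₃ ^ q * u₄ + a₄ ^ q * u₃)
        (huq : u₁ * u₂ ^ q + u₂ * u₁ ^ q = u₃ * u₄ ^ q + u₄ * u₃ ^ q) :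
        ∃ c : K, c ≠ 0 ∧ c ^ q = c ∧
          ((a₁ = c * a₃ ∧ u₁ = c * u₃) ∨ (a₁ = c * a₄ ∧ u₁ = c * u₄)) := by
      rcases mul_eq_zero.mp h0 with h30 | h40
      · exact exists_pow_eq_self_mul_pair_of_eq_zero hq h10 h30 (h₁.resolve_left (by simp [h10]))
          (h₃.resolve_left (by simp [h30])) h₄ hu hau hauq huq
      · obtain ⟨c, hc, hcq, h⟩ := exists_pow_eq_self_mul_pair_of_eq_zero hq h10 h40
          (h₁.resolve_left (by simp [h10])) (h₄.resolve_left (by simp [h40])) h₃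
          (hu.trans (mul_comm _ _)) (hau.trans (add_comm _ _)) (hauq.trans (add_comm _ _))
          (huq.trans (add_comm _ _))
        exact ⟨c, hc, hcq, h.symm⟩
    rcases mul_eq_zero.mp (ha.trans h0) with h10 | h20
    · obtain ⟨c, hc, hcq, h⟩ := one h₁ h10 hu hau hauq huq
      exact ⟨c, hc, hcq, by tauto⟩
    · obtain ⟨c, hc, hcq, h⟩ := one h₂ h20 ((mul_comm _ _).trans hu) ((add_comm _ _).trans hau)
        ((add_comm _ _).trans hauq) ((add_comm _ _).trans huq)
      exact ⟨c, hc, hcq, by tauto⟩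
  · have h0' := ha ▸ h0
    obtain ⟨c, hc, hcq, h | h⟩ := exists_pow_eq_self_mul_of_mul_eq (left_ne_zero_of_mul h0')
      (left_ne_zero_of_mul h0) (right_ne_zero_of_mul h0) ha haq
    · obtain ⟨c, hc, hcq, h⟩ := exists_pow_eq_self_mul_pair_of_eq_mul (right_ne_zero_of_mul h0')
        (left_ne_zero_of_mul h0) hc hcq h ha hu hau hauq
      exact ⟨c, hc, hcq, by tauto⟩
    · obtain ⟨c, hc, hcq, h⟩ := exists_pow_eq_self_mul_pair_of_eq_mul (right_ne_zero_of_mul h0')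
        (right_ne_zero_of_mul h0) hc hcq h (ha.trans (mul_comm _ _)) (hu.trans (mul_comm _ _))
        (hau.trans (add_comm _ _)) (hauq.trans (add_comm _ _))
      exact ⟨c, hc, hcq, by tauto⟩

open Polynomial in
/-- In a field containing the field `F` of order `q`, the solutions of `x ^ q = x` lie in `F`. -/
theorem Subfield.mem_of_pow_natCard_eq_self {K : Type*} [Field K] (F : Subfield K) [Finite F]
    {x : K} (hx : x ^ Nat.card F = x) : x ∈ F := by
  have := Fintype.ofFinite F
  have hs : (X ^ Fintype.card F - X : F[X]).Splits := by
    rw [splits_iff_card_roots, FiniteField.roots_X_pow_card_sub_X, ← Finset.card_def,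
      Finset.card_univ, FiniteField.X_pow_card_sub_X_natDegree_eq _ Fintype.one_lt_card]
  obtain ⟨a, rfl⟩ := hs.mem_range_of_isRoot (i := F.subtype) (x := x)
    (FiniteField.X_pow_card_sub_X_ne_zero F Fintype.one_lt_card)
    (by simp [hx, ← Nat.card_eq_fintype_card])
  exact a.2

/-- Coefficients in a subfield `L` of a relation `∑ cᵢ xⁱ = 0` of length at most the degree of `x`
over `L` vanish. -/
theorem Subfield.eq_zero_of_sum_mul_pow_eq_zero {K : Type*} [Field K] {L : Subfield K} {x : K}
    {N : ℕ} (hN : N ≤ (minpoly L x).natDegree) (c : Fin N → K) (hc : ∀ i, c i ∈ L)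
    (h : ∑ i, c i * x ^ (i : ℕ) = 0) (i : Fin N) : c i = 0 := by
  have hli := (linearIndependent_pow (K := L) x).comp (Fin.castLE hN) (Fin.castLE_injective hN)
  have := Fintype.linearIndependent_iff.mp hli (fun i => ⟨c i, hc i⟩)
    (by simpa [Subfield.smul_def] using h) i
  exact congrArg Subtype.val this

/-- If `1, x, x²` are independent over `L`, a relation between them is trivial. -/
theorem Subfield.eq_zero_of_quadratic_eq_zero {K : Type*} [Field K] {L : Subfield K} {x : K}
    (hx : 3 ≤ (minpoly L x).natDegree) {c₀ c₁ c₂ : K} (h₀ : c₀ ∈ L) (h₁ : c₁ ∈ L) (h₂ : c₂ ∈ L)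
    (h : c₀ + c₁ * x + c₂ * x ^ 2 = 0) : c₀ = 0 ∧ c₁ = 0 ∧ c₂ = 0 := by
  have key := eq_zero_of_sum_mul_pow_eq_zero hx ![c₀, c₁, c₂]
    (by simp [Fin.forall_fin_succ, h₀, h₁, h₂]) (by simpa [Fin.sum_univ_succ, add_assoc] using h)
  exact ⟨key 0, key 1, key 2⟩

/-- If `1, x, …, x⁴` are independent over `L`, a relation between them is trivial. -/
theorem Subfield.eq_zero_of_quartic_eq_zero {K : Type*} [Field K] {L : Subfield K} {x : K}
    (hx : 5 ≤ (minpoly L x).natDegree) {c₀ c₁ c₂ c₃ c₄ : K} (h₀ : c₀ ∈ L) (h₁ : c₁ ∈ L)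
    (h₂ : c₂ ∈ L) (h₃ : c₃ ∈ L) (h₄ : c₄ ∈ L)
    (h : c₀ + c₁ * x + c₂ * x ^ 2 + c₃ * x ^ 3 + c₄ * x ^ 4 = 0) :
    c₀ = 0 ∧ c₁ = 0 ∧ c₂ = 0 ∧ c₃ = 0 ∧ c₄ = 0 := by
  have key := eq_zero_of_sum_mul_pow_eq_zero hx ![c₀, c₁, c₂, c₃, c₄]
    (by simp [Fin.forall_fin_succ, h₀, h₁, h₂, h₃, h₄])
    (by simpa [Fin.sum_univ_succ, add_assoc] using h)
  exact ⟨key 0, key 1, key 2, key 3, key 4⟩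

/-- The point of the space with coordinates `a` and `u`. -/
def twoGeneratorPoint {K : Type*} [Field K] (q : ℕ) (δ₁ δ₂ τ₁ τ₂ γ ξ a u : K) : K :=
  δ₁ * a + δ₂ * a ^ q * ξ + τ₁ * u * γ + τ₂ * u ^ q * γ ^ 2

section

variable {K : Type*} [Field K] {q : ℕ} {Fk Fm : Subfield K} {δ₁ δ₂ τ₁ τ₂ γ ξ : K}

theorem twoGeneratorPoint_mul_left {c : K} (hcq : c ^ q = c) (a u : K) :
    twoGeneratorPoint q δ₁ δ₂ τ₁ τ₂ γ ξ (c * a) (c * u) =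
      c * twoGeneratorPoint q δ₁ δ₂ τ₁ τ₂ γ ξ a u := by
  simp only [twoGeneratorPoint, mul_pow, hcq]
  ring

theorem twoGeneratorPoint_add (hadd : ∀ x y : K, (x + y) ^ q = x ^ q + y ^ q) (a b u v : K) :
    twoGeneratorPoint q δ₁ δ₂ τ₁ τ₂ γ ξ (a + b) (u + v) =
      twoGeneratorPoint q δ₁ δ₂ τ₁ τ₂ γ ξ a u + twoGeneratorPoint q δ₁ δ₂ τ₁ τ₂ γ ξ b v := by
  simp only [twoGeneratorPoint, hadd]
  ring

theorem twoGeneratorPoint_inj (hFkFm : Fk ≤ Fm) (hγFm : γ ∈ Fm)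
    (hγ : 5 ≤ (minpoly Fk γ).natDegree) (hξ : 3 ≤ (minpoly Fm ξ).natDegree)
    (hδ₁ : δ₁ ∈ Fk) (hδ₂ : δ₂ ∈ Fk) (hτ₁ : τ₁ ∈ Fk) (hτ₂ : τ₂ ∈ Fk)
    (hδ₁0 : δ₁ ≠ 0) (hτ₁0 : τ₁ ≠ 0) {a b u v : K}
    (ha : a ∈ Fk) (hb : b ∈ Fk) (hu : u ∈ Fk) (hv : v ∈ Fk)
    (h : twoGeneratorPoint q δ₁ δ₂ τ₁ τ₂ γ ξ a u = twoGeneratorPoint q δ₁ δ₂ τ₁ τ₂ γ ξ b v) :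
    a = b ∧ u = v := by
  unfold twoGeneratorPoint at h
  obtain ⟨h₀, -, -⟩ := Subfield.eq_zero_of_quadratic_eq_zero hξ
    (c₀ := δ₁ * (a - b) + τ₁ * (u - v) * γ + τ₂ * (u ^ q - v ^ q) * γ ^ 2)
    (c₁ := δ₂ * (a ^ q - b ^ q)) (c₂ := 0)
    (add_mem (add_mem (hFkFm (mul_mem hδ₁ (sub_mem ha hb)))
        (mul_mem (hFkFm (mul_mem hτ₁ (sub_mem hu hv))) hγFm))
      (mul_mem (hFkFm (mul_mem hτ₂ (sub_mem (pow_mem hu q) (pow_mem hv q)))) (pow_mem hγFm 2)))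
    (hFkFm (mul_mem hδ₂ (sub_mem (pow_mem ha q) (pow_mem hb q)))) (zero_mem _) (by linear_combination h)
  obtain ⟨h₀, h₁, -⟩ := Subfield.eq_zero_of_quadratic_eq_zero (L := Fk) (by omega)
    (mul_mem hδ₁ (sub_mem ha hb)) (mul_mem hτ₁ (sub_mem hu hv))
    (mul_mem hτ₂ (sub_mem (pow_mem hu q) (pow_mem hv q))) h₀
  exact ⟨sub_eq_zero.mp ((mul_eq_zero.mp h₀).resolve_left hδ₁0),
    sub_eq_zero.mp ((mul_eq_zero.mp h₁).resolve_left hτ₁0)⟩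

theorem exists_pow_eq_self_mul_of_twoGeneratorPoint_mul_eq (hq : q ≠ 0)
    (hinj : Function.Injective fun x : K => x ^ q) (hFkFm : Fk ≤ Fm) (hγFm : γ ∈ Fm)
    (hγ : 5 ≤ (minpoly Fk γ).natDegree) (hξ : 3 ≤ (minpoly Fm ξ).natDegree)
    (hδ₁ : δ₁ ∈ Fk) (hδ₂ : δ₂ ∈ Fk) (hτ₁ : τ₁ ∈ Fk) (hτ₂ : τ₂ ∈ Fk)
    (hδ₁0 : δ₁ ≠ 0) (hδ₂0 : δ₂ ≠ 0) (hτ₁0 : τ₁ ≠ 0) (hτ₂0 : τ₂ ≠ 0)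
    {a₁ a₂ a₃ a₄ u₁ u₂ u₃ u₄ : K}
    (ha₁ : a₁ ∈ Fk) (ha₂ : a₂ ∈ Fk) (ha₃ : a₃ ∈ Fk) (ha₄ : a₄ ∈ Fk)
    (hu₁ : u₁ ∈ Fk) (hu₂ : u₂ ∈ Fk) (hu₃ : u₃ ∈ Fk) (hu₄ : u₄ ∈ Fk)
    (h₁ : a₁ ≠ 0 ∨ u₁ ≠ 0) (h₂ : a₂ ≠ 0 ∨ u₂ ≠ 0)
    (h₃ : a₃ ≠ 0 ∨ u₃ ≠ 0) (h₄ : a₄ ≠ 0 ∨ u₄ ≠ 0)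
    (h : twoGeneratorPoint q δ₁ δ₂ τ₁ τ₂ γ ξ a₁ u₁ * twoGeneratorPoint q δ₁ δ₂ τ₁ τ₂ γ ξ a₂ u₂ =
      twoGeneratorPoint q δ₁ δ₂ τ₁ τ₂ γ ξ a₃ u₃ * twoGeneratorPoint q δ₁ δ₂ τ₁ τ₂ γ ξ a₄ u₄) :
    ∃ c : K, c ≠ 0 ∧ c ^ q = c ∧
      ((a₁ = c * a₃ ∧ u₁ = c * u₃) ∨ (a₁ = c * a₄ ∧ u₁ = c * u₄) ∨
        (a₂ = c * a₃ ∧ u₂ = c * u₃) ∨ (a₂ = c * a₄ ∧ u₂ = c * u₄)) := by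
  unfold twoGeneratorPoint at h
  have mem_Fm {a u : K} (ha : a ∈ Fk) (hu : u ∈ Fk) :
      δ₁ * a + τ₁ * u * γ + τ₂ * u ^ q * γ ^ 2 ∈ Fm :=
    add_mem (add_mem (hFkFm (mul_mem hδ₁ ha)) (mul_mem (hFkFm (mul_mem hτ₁ hu)) hγFm))
      (mul_mem (hFkFm (mul_mem hτ₂ (pow_mem hu q))) (pow_mem hγFm 2))
  have mem_Fm' {a : K} (ha : a ∈ Fk) : δ₂ * a ^ q ∈ Fm := hFkFm (mul_mem hδ₂ (pow_mem ha q))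
  obtain ⟨e₀, e₁, -⟩ := Subfield.eq_zero_of_quadratic_eq_zero hξ
    (sub_mem (mul_mem (mem_Fm ha₁ hu₁) (mem_Fm ha₂ hu₂))
      (mul_mem (mem_Fm ha₃ hu₃) (mem_Fm ha₄ hu₄)))
    (sub_mem
      (add_mem (mul_mem (mem_Fm ha₁ hu₁) (mem_Fm' ha₂)) (mul_mem (mem_Fm ha₂ hu₂) (mem_Fm' ha₁)))
      (add_mem (mul_mem (mem_Fm ha₃ hu₃) (mem_Fm' ha₄)) (mul_mem (mem_Fm ha₄ hu₄) (mem_Fm' ha₃))))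
    (sub_mem (mul_mem (mem_Fm' ha₁) (mem_Fm' ha₂)) (mul_mem (mem_Fm' ha₃) (mem_Fm' ha₄)))
    (by linear_combination h)
  obtain ⟨f₀, f₁, -, f₃, f₄⟩ := Subfield.eq_zero_of_quartic_eq_zero hγ
    (c₀ := δ₁ ^ 2 * (a₁ * a₂ - a₃ * a₄))
    (c₁ := δ₁ * τ₁ * (a₁ * u₂ + a₂ * u₁ - (a₃ * u₄ + a₄ * u₃)))
    (c₂ := δ₁ * τ₂ * (a₁ * u₂ ^ q + a₂ * u₁ ^ q - (a₃ * u₄ ^ q + a₄ * u₃ ^ q)) +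
      τ₁ ^ 2 * (u₁ * u₂ - u₃ * u₄))
    (c₃ := τ₁ * τ₂ * (u₁ * u₂ ^ q + u₂ * u₁ ^ q - (u₃ * u₄ ^ q + u₄ * u₃ ^ q)))
    (c₄ := τ₂ ^ 2 * (u₁ ^ q * u₂ ^ q - u₃ ^ q * u₄ ^ q))
    (by apply_rules [add_mem, sub_mem, mul_mem, pow_mem])
    (by apply_rules [add_mem, sub_mem, mul_mem, pow_mem])
    (by apply_rules [add_mem, sub_mem, mul_mem, pow_mem])
    (by apply_rules [add_mem, sub_mem, mul_mem, pow_mem])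
    (by apply_rules [add_mem, sub_mem, mul_mem, pow_mem]) (by linear_combination e₀)
  obtain ⟨g₀, g₁, -⟩ := Subfield.eq_zero_of_quadratic_eq_zero (L := Fk) (x := γ) (by omega)
    (c₀ := δ₁ * δ₂ * (a₁ * a₂ ^ q + a₂ * a₁ ^ q - (a₃ * a₄ ^ q + a₄ * a₃ ^ q)))
    (c₁ := τ₁ * δ₂ * (a₁ ^ q * u₂ + a₂ ^ q * u₁ - (a₃ ^ q * u₄ + a₄ ^ q * u₃)))
    (c₂ := τ₂ * δ₂ * (u₁ ^ q * a₂ ^ q + u₂ ^ q * a₁ ^ q - (u₃ ^ q * a₄ ^ q + u₄ ^ q * a₃ ^ q)))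
    (by apply_rules [add_mem, sub_mem, mul_mem, pow_mem])
    (by apply_rules [add_mem, sub_mem, mul_mem, pow_mem])
    (by apply_rules [add_mem, sub_mem, mul_mem, pow_mem]) (by linear_combination e₁)
  simp only [mul_eq_zero, pow_eq_zero_iff two_ne_zero, hδ₁0, hδ₂0, hτ₁0, hτ₂0, false_or,
    sub_eq_zero] at f₀ f₁ f₃ f₄ g₀ g₁
  exact exists_pow_eq_self_mul_pair hq h₁ h₂ h₃ h₄ f₀
    (hinj (by simpa only [mul_pow] using f₄)) g₀ f₁ g₁ f₃

end

/-- Equal products with a pair of factors proportional over `F` have the same factors up to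
scalars in `F`. -/
theorem span_singleton_pair_eq_of_mul_eq {K : Type*} [Field K] {F : Subfield K} {x y z w c : K}
    (hz : z ≠ 0) (hc : c ≠ 0) (hcF : c ∈ F) (hx : x = c * z) (h : x * y = z * w) :
    ({span F {x}, span F {y}} : Set (Submodule F K)) = {span F {z}, span F {w}} := by
  have span_mul (t : K) : span F {c * t} = span F {t} :=
    span_singleton_smul_eq (r := (⟨c, hcF⟩ : F))
      (isUnit_iff_ne_zero.mpr fun h => hc (congrArg Subtype.val h)) t
  subst hx
  obtain rfl : w = c * y := mul_left_cancel₀ hz (by linear_combination -h)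
  rw [span_mul, span_mul]

/-- For `k ∣ m ∣ n`, `γ ∈ F_{q^m}^*` a root of an irreducible polynomial of
degree `m/k > 4` over `F_{q^k}`, `ξ ∈ F_{q^n}^*` a root of an irreducible polynomial of
degree `n/m > 2` over `F_{q^m}`, and `δ₁, δ₂, τ₁, τ₂ ∈ F_{q^k}^*`, the set
`U = {δ₁a + δ₂aᑫξ + τ₁uγ + τ₂uᑫγ² : a, u ∈ F_{q^k}}` is a Sidon space of dimension `2k`. -/
theorem sidonSpace_two_generators_dim2k' {K : Type*} [Field K] (q n k m : ℕ)
    (hq : IsPrimePow q) (hn : 0 < n) (hk : 0 < k) (hm : 0 < m)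
    (hkm : k ∣ m) (hmn : m ∣ n)
    (hK : Nat.card K = q ^ n)
    (F : Subfield K) (hF : Nat.card F = q)
    (Fk : Subfield K) (hFk : Nat.card Fk = q ^ k) (hFFk : F ≤ Fk)
    (Fm : Subfield K) (hFm : Nat.card Fm = q ^ m) (hFkFm : Fk ≤ Fm)
    (γ : K) (hγFm : γ ∈ Fm) (hγ : γ ≠ 0)
    (hdegγ : (minpoly Fk γ).natDegree = m / k) (hdegγ4 : 4 < m / k)
    (ξ : K) (hξ : ξ ≠ 0)
    (hdegξ : (minpoly Fm ξ).natDegree = n / m) (hdegξ2 : 2 < n / m)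
    (δ₁ δ₂ τ₁ τ₂ : K) (hδ₁ : δ₁ ∈ Fk) (hδ₂ : δ₂ ∈ Fk) (hτ₁ : τ₁ ∈ Fk) (hτ₂ : τ₂ ∈ Fk)
    (hδ₁0 : δ₁ ≠ 0) (hδ₂0 : δ₂ ≠ 0) (hτ₁0 : τ₁ ≠ 0) (hτ₂0 : τ₂ ≠ 0) :
    IsSidonSpace F
        (Submodule.span F
          {x : K | ∃ a ∈ Fk, ∃ u ∈ Fk,
            x = δ₁ * a + δ₂ * a ^ q * ξ + τ₁ * u * γ + τ₂ * u ^ q * γ ^ 2}) ∧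
      Module.finrank F
        ↥(Submodule.span F
          {x : K | ∃ a ∈ Fk, ∃ u ∈ Fk,
            x = δ₁ * a + δ₂ * a ^ q * ξ + τ₁ * u * γ + τ₂ * u ^ q * γ ^ 2}) = 2 * k := by
  have hcard : Nat.card K ≠ 0 := by
    rw [hK]
    exact pow_ne_zero _ hq.ne_zero
  have : Finite K := Nat.finite_of_card_ne_zero hcard
  have : Fintype F := Fintype.ofFinite F
  have hFcard : Fintype.card F = q := by rw [← Nat.card_eq_fintype_card, hF]
  have hfrob (x : K) : FiniteField.frobeniusAlgHom F K x = x ^ q := by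
    rw [FiniteField.frobeniusAlgHom_apply, hFcard]
  have hadd (x y : K) : (x + y) ^ q = x ^ q + y ^ q := by
    simpa only [hfrob] using map_add (FiniteField.frobeniusAlgHom F K) x y
  have hinj : Function.Injective fun x : K => x ^ q :=
    (funext hfrob : ⇑(FiniteField.frobeniusAlgHom F K) = _) ▸
      (FiniteField.frobeniusAlgHom F K).toRingHom.injective
  have hfix (c : F) : (c : K) ^ q = c :=
    (hfrob c).symm.trans ((FiniteField.frobeniusAlgHom F K).commutes c)
  have hγ5 : 5 ≤ (minpoly Fk γ).natDegree := by omega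
  have hξ3 : 3 ≤ (minpoly Fm ξ).natDegree := by omega
  let P : K → K → K := twoGeneratorPoint q δ₁ δ₂ τ₁ τ₂ γ ξ
  have hP0 : P 0 0 = 0 := by simp [P, twoGeneratorPoint, hq.ne_zero]
  let W : Submodule F K :=
    { carrier := {x | ∃ a ∈ Fk, ∃ u ∈ Fk, x = P a u}
      zero_mem' := ⟨0, zero_mem _, 0, zero_mem _, hP0.symm⟩
      add_mem' := by
        rintro _ _ ⟨a, ha, u, hu, rfl⟩ ⟨b, hb, v, hv, rfl⟩
        exact ⟨a + b, add_mem ha hb, u + v, add_mem hu hv,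
          (twoGeneratorPoint_add hadd a b u v).symm⟩
      smul_mem' := by
        rintro c _ ⟨a, ha, u, hu, rfl⟩
        exact ⟨c * a, mul_mem (hFFk c.2) ha, c * u, mul_mem (hFFk c.2) hu,
          (twoGeneratorPoint_mul_left (hfix c) a u).symm⟩ }
  have hW : Submodule.span F {x : K | ∃ a ∈ Fk, ∃ u ∈ Fk,
      x = δ₁ * a + δ₂ * a ^ q * ξ + τ₁ * u * γ + τ₂ * u ^ q * γ ^ 2} = W :=
    Submodule.span_eq W
  rw [hW]
  constructor
  · rintro _ ⟨a₁, ha₁, u₁, hu₁, rfl⟩ _ ⟨a₂, ha₂, u₂, hu₂, rfl⟩ _ ⟨a₃, ha₃, u₃, hu₃, rfl⟩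
      _ ⟨a₄, ha₄, u₄, hu₄, rfl⟩ h₁ h₂ h₃ h₄ h
    have ne_zero {a u : K} (h : P a u ≠ 0) : a ≠ 0 ∨ u ≠ 0 := by
      by_contra! h'
      exact h (by rw [h'.1, h'.2, hP0])
    obtain ⟨c, hc, hcq, h'⟩ := exists_pow_eq_self_mul_of_twoGeneratorPoint_mul_eq hq.ne_zero hinj
      hFkFm hγFm hγ5 hξ3 hδ₁ hδ₂ hτ₁ hτ₂ hδ₁0 hδ₂0 hτ₁0 hτ₂0 ha₁ ha₂ ha₃ ha₄ hu₁ hu₂ hu₃ hu₄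
      (ne_zero h₁) (ne_zero h₂) (ne_zero h₃) (ne_zero h₄) h
    have hcF : c ∈ F := F.mem_of_pow_natCard_eq_self (by rw [hF, hcq])
    have hmul {a b u v : K} (h : a = c * b ∧ u = c * v) : P a u = c * P b v := by
      rw [h.1, h.2]
      exact twoGeneratorPoint_mul_left hcq b v
    rcases h' with h' | h' | h' | h'
    · exact span_singleton_pair_eq_of_mul_eq h₃ hc hcF (hmul h') h
    · rw [Set.pair_comm (span F {P a₃ u₃})]
      exact span_singleton_pair_eq_of_mul_eq h₄ hc hcF (hmul h') (h.trans (mul_comm _ _))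
    · rw [Set.pair_comm (span F {P a₁ u₁})]
      exact span_singleton_pair_eq_of_mul_eq h₃ hc hcF (hmul h') ((mul_comm _ _).trans h)
    · rw [Set.pair_comm (span F {P a₁ u₁}), Set.pair_comm (span F {P a₃ u₃})]
      exact span_singleton_pair_eq_of_mul_eq h₄ hc hcF (hmul h')
        ((mul_comm _ _).trans (h.trans (mul_comm _ _)))
  · let e : Fk × Fk → W := fun p => ⟨P p.1 p.2, p.1, p.1.2, p.2, p.2.2, rfl⟩
    have he : Function.Bijective e := by
      constructor
      · rintro ⟨a, u⟩ ⟨b, v⟩ h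
        have := twoGeneratorPoint_inj hFkFm hγFm hγ5 hξ3 hδ₁ hδ₂ hτ₁ hτ₂ hδ₁0 hτ₁0 a.2 b.2 u.2 v.2
          (congrArg Subtype.val h)
        exact Prod.ext (Subtype.ext this.1) (Subtype.ext this.2)
      · rintro ⟨_, a, ha, u, hu, rfl⟩
        exact ⟨(⟨a, ha⟩, ⟨u, hu⟩), rfl⟩
    have hWcard : q ^ Module.finrank F W = q ^ (2 * k) := by
      rw [two_mul, pow_add, ← hFk, ← Nat.card_prod, Nat.card_congr (Equiv.ofBijective e he),
        Module.natCard_eq_pow_finrank (K := F), hF]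
    exact Nat.pow_right_injective hq.two_le hWcard
end

section
/- Let q be a prime power and n, k, l positive integers with kl | n and gcd(k, l) = 1. Let γ ∈ F_{q^n}^* be a root of an irreducible polynomial of degree n/(kl) over F_{q^{kl}}, where n/(kl) > 8, and let δ_1, δ_2 ∈ F_{q^l}^* and τ_1, τ_2 ∈ F_{q^k}^*. Then U = {a + δ_1 u γ + δ_2 u^q γ^2 + τ_1 e γ^3 + τ_2 e^q γ^4 : a ∈ F_q, u ∈ F_{q^l}, e ∈ F_{q^k}} is a Sidon space of F_q-dimension k + l + 1. -/
open Submodule Pointwise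

set_option maxHeartbeats 1000000
set_option synthInstance.maxHeartbeats 400000

section FieldIdentities

variable {K : Type*} [Field K] (φ : K →+* K)

/-- Two pairs with the same product and the same symmetrised twisted product `x φ(y) + y φ(x)`
agree up to swapping and scaling by an element fixed by `φ`. -/
lemma exists_fixed_scalar_of_twisted_product_eq {x₁ x₂ x₃ x₄ : K}
    (h₁ : x₁ ≠ 0) (h₃ : x₃ ≠ 0) (h₄ : x₄ ≠ 0) (hprod : x₁ * x₂ = x₃ * x₄)
    (htwist : x₁ * φ x₂ + x₂ * φ x₁ = x₃ * φ x₄ + x₄ * φ x₃) :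
    ∃ c, φ c = c ∧ c ≠ 0 ∧ (x₃ = c * x₁ ∨ x₄ = c * x₁) := by
  have hφ : φ x₁ * φ x₂ = φ x₃ * φ x₄ := by rw [← map_mul, hprod, map_mul]
  have key : (φ x₁ * x₃ - φ x₃ * x₁) * (φ x₁ * x₄ - φ x₄ * x₁) = 0 := by
    linear_combination (-φ x₁ ^ 2) * hprod + φ x₁ * x₁ * htwist - x₁ ^ 2 * hφ
  have hφ₁ : φ x₁ ≠ 0 := (map_ne_zero φ).2 h₁
  have fixed : ∀ y, y ≠ 0 → φ x₁ * y - φ y * x₁ = 0 →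
      φ (y / x₁) = y / x₁ ∧ y / x₁ ≠ 0 ∧ y = y / x₁ * x₁ := by
    intro y hy h
    refine ⟨?_, div_ne_zero hy h₁, (div_mul_cancel₀ y h₁).symm⟩
    rw [map_div₀, div_eq_div_iff hφ₁ h₁]
    linear_combination -h
  rcases mul_eq_zero.1 key with h | h
  · obtain ⟨hc, hc0, hc1⟩ := fixed _ h₃ h
    exact ⟨_, hc, hc0, .inl hc1⟩
  · obtain ⟨hc, hc0, hc1⟩ := fixed _ h₄ h
    exact ⟨_, hc, hc0, .inr hc1⟩

/-- Equal products of the linear polynomials `aᵢ + uᵢ Y`, in the case where the first and third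
factors are proportional: the factor of proportionality is fixed by `φ`, up to swapping. -/
lemma exists_fixed_scalar_of_proportional {a₁ a₂ a₃ a₄ u₁ u₂ u₃ u₄ : K}
    (ha₁ : φ a₁ = a₁) (ha₂ : φ a₂ = a₂) (ha₃ : φ a₃ = a₃) (ha₄ : φ a₄ = a₄)
    (h₁ : a₁ ≠ 0 ∨ u₁ ≠ 0) (h₃ : a₃ ≠ 0 ∨ u₃ ≠ 0) (h₄ : a₄ ≠ 0 ∨ u₄ ≠ 0)
    (h0 : a₁ * a₂ = a₃ * a₄) (h1 : a₁ * u₂ + a₂ * u₁ = a₃ * u₄ + a₄ * u₃)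
    (h2 : u₁ * u₂ = u₃ * u₄)
    (h3 : a₁ = 0 → a₂ = 0 → a₃ = 0 → a₄ = 0 →
      u₁ * φ u₂ + u₂ * φ u₁ = u₃ * φ u₄ + u₄ * φ u₃)
    (hprop : a₁ * u₃ = a₃ * u₁) :
    ∃ c, φ c = c ∧ c ≠ 0 ∧ ((a₃ = c * a₁ ∧ u₃ = c * u₁) ∨ (a₄ = c * a₁ ∧ u₄ = c * u₁)) := by
  by_cases h : a₁ = 0
  · have hu₁ : u₁ ≠ 0 := h₁.resolve_left (not_not.2 h)
    have ha3 : a₃ = 0 := by simpa [h, hu₁] using hprop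
    have hu₃ : u₃ ≠ 0 := h₃.resolve_left (not_not.2 ha3)
    have h24 : a₂ * u₁ = a₄ * u₃ := by simpa [h, ha3] using h1
    by_cases ha2 : a₂ = 0
    · have ha4 : a₄ = 0 := by simpa [ha2, hu₃] using h24
      have hu₄ : u₄ ≠ 0 := h₄.resolve_left (not_not.2 ha4)
      obtain ⟨c, hc, hc0, h | h⟩ := exists_fixed_scalar_of_twisted_product_eq φ hu₁ hu₃ hu₄ h2
        (h3 ‹_› ha2 ha3 ha4)
      · exact ⟨c, hc, hc0, .inl ⟨by simp [*], h⟩⟩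
      · exact ⟨c, hc, hc0, .inr ⟨by simp [*], h⟩⟩
    · have ha4 : a₄ ≠ 0 := by
        rintro rfl
        simp [ha2, hu₁] at h24
      refine ⟨a₂ / a₄, by rw [map_div₀, ha₂, ha₄], div_ne_zero ha2 ha4,
        .inl ⟨by simp [h, ha3], ?_⟩⟩
      field_simp
      linear_combination -h24
  · have ha3 : a₃ ≠ 0 := by
      intro h'
      have : u₃ = 0 := by simpa [h', h] using hprop
      exact h₃.elim (· h') (· this)
    refine ⟨a₃ / a₁, by rw [map_div₀, ha₁, ha₃], div_ne_zero ha3 h, .inl ⟨by field_simp, ?_⟩⟩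
    field_simp
    linear_combination hprop

/-- Equal products of nonzero linear polynomials `aᵢ + uᵢ Y` have proportional factors, up to
swapping. -/
lemma exists_fixed_scalar_of_linear_product_eq {a₁ a₂ a₃ a₄ u₁ u₂ u₃ u₄ : K}
    (ha₁ : φ a₁ = a₁) (ha₂ : φ a₂ = a₂) (ha₃ : φ a₃ = a₃) (ha₄ : φ a₄ = a₄)
    (h₁ : a₁ ≠ 0 ∨ u₁ ≠ 0) (h₃ : a₃ ≠ 0 ∨ u₃ ≠ 0) (h₄ : a₄ ≠ 0 ∨ u₄ ≠ 0)
    (h0 : a₁ * a₂ = a₃ * a₄) (h1 : a₁ * u₂ + a₂ * u₁ = a₃ * u₄ + a₄ * u₃)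
    (h2 : u₁ * u₂ = u₃ * u₄)
    (h3 : a₁ = 0 → a₂ = 0 → a₃ = 0 → a₄ = 0 →
      u₁ * φ u₂ + u₂ * φ u₁ = u₃ * φ u₄ + u₄ * φ u₃) :
    ∃ c, φ c = c ∧ c ≠ 0 ∧ ((a₃ = c * a₁ ∧ u₃ = c * u₁) ∨ (a₄ = c * a₁ ∧ u₄ = c * u₁)) := by
  have key : (a₁ * u₃ - a₃ * u₁) * (a₁ * u₄ - a₄ * u₁) = 0 := by
    linear_combination (-a₁ ^ 2) * h2 + a₁ * u₁ * h1 - u₁ ^ 2 * h0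
  rcases mul_eq_zero.1 key with h | h
  · exact exists_fixed_scalar_of_proportional φ ha₁ ha₂ ha₃ ha₄ h₁ h₃ h₄ h0 h1 h2 h3
      (sub_eq_zero.1 h)
  · obtain ⟨c, hc, hc0, h'⟩ := exists_fixed_scalar_of_proportional φ ha₁ ha₂ ha₄ ha₃ h₁ h₄ h₃
      (by rw [h0, mul_comm]) (by rw [h1, add_comm]) (by rw [h2, mul_comm])
      (fun x y z w ↦ by rw [h3 x y w z, add_comm]) (sub_eq_zero.1 h)
    exact ⟨c, hc, hc0, h'.symm⟩

/-- If the product of `a + u Y` and `b + v Y` vanishes, one of the factors does. -/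
lemma linear_eq_zero_or_eq_zero {a b u v : K} (hab : a * b = 0) (hav : a * v + b * u = 0)
    (huv : u * v = 0) : (a = 0 ∧ u = 0) ∨ (b = 0 ∧ v = 0) := by
  rcases mul_eq_zero.1 hab with rfl | rfl <;> rcases mul_eq_zero.1 huv with rfl | rfl <;>
    simp_all [or_comm]

end FieldIdentities

/-- The element `a + δ₁uγ + δ₂φ(u)γ² + τ₁eγ³ + τ₂φ(e)γ⁴`. -/
def sumThree {K : Type*} [Field K] (φ : K →+* K) (γ δ₁ δ₂ τ₁ τ₂ a u e : K) : K :=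
  a + δ₁ * u * γ + δ₂ * φ u * γ ^ 2 + τ₁ * e * γ ^ 3 + τ₂ * φ e * γ ^ 4

lemma sumThree_mul_left {K : Type*} [Field K] {φ : K →+* K} {c : K} (hc : φ c = c)
    (γ δ₁ δ₂ τ₁ τ₂ a u e : K) :
    sumThree φ γ δ₁ δ₂ τ₁ τ₂ (c * a) (c * u) (c * e) =
      c * sumThree φ γ δ₁ δ₂ τ₁ τ₂ a u e := by
  simp only [sumThree, map_mul, hc]
  ring

/-- The assumptions on the subfields, the Frobenius map `φ` and the coefficients under which
the elements `sumThree` are studied. -/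
structure SumThreeSetup {K : Type*} [Field K] (F Fk Fl L : Subfield K) (φ : K →+* K)
    (γ δ₁ δ₂ τ₁ τ₂ : K) : Prop where
  fixed_iff : ∀ x, φ x = x ↔ x ∈ F
  map_mem_k : ∀ x ∈ Fk, φ x ∈ Fk
  map_mem_l : ∀ x ∈ Fl, φ x ∈ Fl
  le_k : F ≤ Fk
  le_l : F ≤ Fl
  k_le : Fk ≤ L
  l_le : Fl ≤ L
  inf_le : ∀ x ∈ Fk, x ∈ Fl → x ∈ F
  indep : ∀ c : Fin 9 → K, (∀ i, c i ∈ L) → ∑ i, c i * γ ^ (i : ℕ) = 0 → ∀ i, c i = 0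
  δ₁_mem : δ₁ ∈ Fl
  δ₂_mem : δ₂ ∈ Fl
  δ₁_ne : δ₁ ≠ 0
  δ₂_ne : δ₂ ≠ 0
  τ₁_mem : τ₁ ∈ Fk
  τ₂_mem : τ₂ ∈ Fk
  τ₁_ne : τ₁ ≠ 0
  τ₂_ne : τ₂ ≠ 0

/-- The relations obtained by comparing coefficients of powers of `γ` in an equality of products
of two elements `sumThree`. -/
structure ProductRelations {K : Type*} [Field K] (φ : K →+* K) (δ₁ δ₂ τ₁ τ₂ : K)
    (a₁ u₁ e₁ a₂ u₂ e₂ a₃ u₃ e₃ a₄ u₄ e₄ : K) : Prop where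
  aa : a₁ * a₂ = a₃ * a₄
  au : a₁ * u₂ + a₂ * u₁ = a₃ * u₄ + a₄ * u₃
  uu : u₁ * u₂ = u₃ * u₄
  cubic : τ₁ * (a₁ * e₂ + a₂ * e₁) + δ₁ * δ₂ * (u₁ * φ u₂ + u₂ * φ u₁) =
    τ₁ * (a₃ * e₄ + a₄ * e₃) + δ₁ * δ₂ * (u₃ * φ u₄ + u₄ * φ u₃)
  quartic : τ₂ * φ (a₁ * e₂ + a₂ * e₁) + δ₁ * τ₁ * (u₁ * e₂ + u₂ * e₁) =
    τ₂ * φ (a₃ * e₄ + a₄ * e₃) + δ₁ * τ₁ * (u₃ * e₄ + u₄ * e₃)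
  ee_twist : e₁ * φ e₂ + e₂ * φ e₁ = e₃ * φ e₄ + e₄ * φ e₃
  ee : e₁ * e₂ = e₃ * e₄

namespace SumThreeSetup

variable {K : Type*} [Field K] {F Fk Fl L : Subfield K} {φ : K →+* K} {γ δ₁ δ₂ τ₁ τ₂ : K}

lemma eq_zero_of_sumThree_eq_zero (S : SumThreeSetup F Fk Fl L φ γ δ₁ δ₂ τ₁ τ₂) {a u e : K}
    (ha : a ∈ F) (hu : u ∈ Fl) (he : e ∈ Fk) (h : sumThree φ γ δ₁ δ₂ τ₁ τ₂ a u e = 0) :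
    a = 0 ∧ u = 0 ∧ e = 0 := by
  have h0 := S.indep ![a, δ₁ * u, δ₂ * φ u, τ₁ * e, τ₂ * φ e, 0, 0, 0, 0] (by
    have := S.k_le (S.le_k ha)
    have := S.l_le (mul_mem S.δ₁_mem hu)
    have := S.l_le (mul_mem S.δ₂_mem (S.map_mem_l _ hu))
    have := S.k_le (mul_mem S.τ₁_mem he)
    have := S.k_le (mul_mem S.τ₂_mem (S.map_mem_k _ he))
    have := L.zero_mem
    intro i
    fin_cases i <;> assumption) (by
    rw [sumThree] at h
    simp [Fin.sum_univ_succ]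
    linear_combination h)
  exact ⟨h0 0, by simpa [S.δ₁_ne] using h0 1, by simpa [S.τ₁_ne] using h0 3⟩

lemma productRelations (S : SumThreeSetup F Fk Fl L φ γ δ₁ δ₂ τ₁ τ₂)
    {a₁ u₁ e₁ a₂ u₂ e₂ a₃ u₃ e₃ a₄ u₄ e₄ : K}
    (ha₁ : a₁ ∈ F) (ha₂ : a₂ ∈ F) (ha₃ : a₃ ∈ F) (ha₄ : a₄ ∈ F)
    (hu₁ : u₁ ∈ Fl) (hu₂ : u₂ ∈ Fl) (hu₃ : u₃ ∈ Fl) (hu₄ : u₄ ∈ Fl)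
    (he₁ : e₁ ∈ Fk) (he₂ : e₂ ∈ Fk) (he₃ : e₃ ∈ Fk) (he₄ : e₄ ∈ Fk)
    (h : sumThree φ γ δ₁ δ₂ τ₁ τ₂ a₁ u₁ e₁ * sumThree φ γ δ₁ δ₂ τ₁ τ₂ a₂ u₂ e₂ =
      sumThree φ γ δ₁ δ₂ τ₁ τ₂ a₃ u₃ e₃ * sumThree φ γ δ₁ δ₂ τ₁ τ₂ a₄ u₄ e₄) :
    ProductRelations φ δ₁ δ₂ τ₁ τ₂ a₁ u₁ e₁ a₂ u₂ e₂ a₃ u₃ e₃ a₄ u₄ e₄ := by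
  let p (a u e b v f : K) : Fin 9 → K := ![a * b,
    a * (δ₁ * v) + b * (δ₁ * u),
    a * (δ₂ * φ v) + b * (δ₂ * φ u) + (δ₁ * u) * (δ₁ * v),
    a * (τ₁ * f) + b * (τ₁ * e) + (δ₁ * u) * (δ₂ * φ v) + (δ₁ * v) * (δ₂ * φ u),
    a * (τ₂ * φ f) + b * (τ₂ * φ e) + (δ₁ * u) * (τ₁ * f) + (δ₁ * v) * (τ₁ * e) +
      (δ₂ * φ u) * (δ₂ * φ v),
    (δ₁ * u) * (τ₂ * φ f) + (δ₁ * v) * (τ₂ * φ e) + (δ₂ * φ u) * (τ₁ * f) +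
      (δ₂ * φ v) * (τ₁ * e),
    (δ₂ * φ u) * (τ₂ * φ f) + (δ₂ * φ v) * (τ₂ * φ e) + (τ₁ * e) * (τ₁ * f),
    (τ₁ * e) * (τ₂ * φ f) + (τ₁ * f) * (τ₂ * φ e),
    (τ₂ * φ e) * (τ₂ * φ f)]
  have hp : ∀ a u e b v f, a ∈ F → u ∈ Fl → e ∈ Fk → b ∈ F → v ∈ Fl → f ∈ Fk →
      ∀ i, p a u e b v f i ∈ L := by
    intro a u e b v f ha hu he hb hv hf
    have A := S.k_le (S.le_k ha)
    have B := S.k_le (S.le_k hb)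
    have U := S.l_le (mul_mem S.δ₁_mem hu)
    have U' := S.l_le (mul_mem S.δ₂_mem (S.map_mem_l _ hu))
    have V := S.l_le (mul_mem S.δ₁_mem hv)
    have V' := S.l_le (mul_mem S.δ₂_mem (S.map_mem_l _ hv))
    have E := S.k_le (mul_mem S.τ₁_mem he)
    have E' := S.k_le (mul_mem S.τ₂_mem (S.map_mem_k _ he))
    have G := S.k_le (mul_mem S.τ₁_mem hf)
    have G' := S.k_le (mul_mem S.τ₂_mem (S.map_mem_k _ hf))
    intro i
    fin_cases i
    · exact mul_mem A B
    · exact add_mem (mul_mem A V) (mul_mem B U)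
    · exact add_mem (add_mem (mul_mem A V') (mul_mem B U')) (mul_mem U V)
    · exact add_mem (add_mem (add_mem (mul_mem A G) (mul_mem B E)) (mul_mem U V')) (mul_mem V U')
    · exact add_mem (add_mem (add_mem (add_mem (mul_mem A G') (mul_mem B E')) (mul_mem U G))
        (mul_mem V E)) (mul_mem U' V')
    · exact add_mem (add_mem (add_mem (mul_mem U G') (mul_mem V E')) (mul_mem U' G)) (mul_mem V' E)
    · exact add_mem (add_mem (mul_mem U' G') (mul_mem V' E')) (mul_mem E G)
    · exact add_mem (mul_mem E G') (mul_mem G E')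
    · exact mul_mem E' G'
  have hsum : ∀ a u e b v f, ∑ i, p a u e b v f i * γ ^ (i : ℕ) =
      sumThree φ γ δ₁ δ₂ τ₁ τ₂ a u e * sumThree φ γ δ₁ δ₂ τ₁ τ₂ b v f := by
    intro a u e b v f
    simp [p, sumThree, Fin.sum_univ_succ]
    ring
  have hcoeff : ∀ i, p a₁ u₁ e₁ a₂ u₂ e₂ i = p a₃ u₃ e₃ a₄ u₄ e₄ i := fun i ↦ sub_eq_zero.1 <|
    S.indep (fun i ↦ p a₁ u₁ e₁ a₂ u₂ e₂ i - p a₃ u₃ e₃ a₄ u₄ e₄ i)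
      (fun i ↦ sub_mem (hp _ _ _ _ _ _ ha₁ hu₁ he₁ ha₂ hu₂ he₂ i)
        (hp _ _ _ _ _ _ ha₃ hu₃ he₃ ha₄ hu₄ he₄ i))
      (by simp only [sub_mul, Finset.sum_sub_distrib, hsum, h, sub_self]) i
  have fix : ∀ x ∈ F, φ x = x := fun x hx ↦ (S.fixed_iff x).2 hx
  have c0 : a₁ * a₂ = a₃ * a₄ := hcoeff 0
  have c1 : a₁ * (δ₁ * u₂) + a₂ * (δ₁ * u₁) = a₃ * (δ₁ * u₄) + a₄ * (δ₁ * u₃) := hcoeff 1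
  have c2 := hcoeff 2
  have c3 := hcoeff 3
  have c4 := hcoeff 4
  have c7 := hcoeff 7
  have c8 := hcoeff 8
  simp only [p, Matrix.cons_val] at c2 c3 c4 c7 c8
  have δ₁_ne := S.δ₁_ne
  have τ₁_ne := S.τ₁_ne
  have τ₂_ne := S.τ₂_ne
  have au : a₁ * u₂ + a₂ * u₁ = a₃ * u₄ + a₄ * u₃ := by
    apply mul_left_cancel₀ δ₁_ne
    linear_combination c1
  have φau := congrArg φ au
  simp only [map_add, map_mul, fix _ ha₁, fix _ ha₂, fix _ ha₃, fix _ ha₄] at φau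
  have uu : u₁ * u₂ = u₃ * u₄ := by
    apply mul_left_cancel₀ (pow_ne_zero 2 δ₁_ne)
    linear_combination c2 - δ₂ * φau
  have φuu := congrArg φ uu
  simp only [map_mul] at φuu
  refine ⟨c0, au, uu, by linear_combination c3, ?_, ?_, ?_⟩
  · simp only [map_add, map_mul, fix _ ha₁, fix _ ha₂, fix _ ha₃, fix _ ha₄]
    linear_combination c4 - δ₂ ^ 2 * φuu
  · apply mul_left_cancel₀ (mul_ne_zero τ₁_ne τ₂_ne)
    linear_combination c7
  · apply φ.injective
    rw [map_mul, map_mul]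
    apply mul_left_cancel₀ (pow_ne_zero 2 τ₂_ne)
    linear_combination c8

/-- Quotients witnessing proportionality of both a pair `(a, u)` over `F`, `Fl` and an element of
`Fk` lie in `F`. -/
lemma scalar_mem (S : SumThreeSetup F Fk Fl L φ γ δ₁ δ₂ τ₁ τ₂) {a b u v s : K}
    (ha : a ∈ F) (hb : b ∈ F) (hu : u ∈ Fl) (hv : v ∈ Fl) (hs : s ∈ Fk)
    (h : a ≠ 0 ∨ u ≠ 0) (hab : b = s * a) (huv : v = s * u) : s ∈ F := by
  by_cases h0 : a = 0
  · have hu0 := h.resolve_left (not_not.2 h0)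
    refine S.inf_le _ hs ?_
    rw [← mul_div_cancel_right₀ s hu0, ← huv]
    exact div_mem hv hu
  · rw [← mul_div_cancel_right₀ s h0, ← hab]
    exact div_mem hb ha

/-- If the parts `(a, u)` of the factors agree, the factors agree up to swapping and scaling. -/
lemma exists_scalar_of_eq (S : SumThreeSetup F Fk Fl L φ γ δ₁ δ₂ τ₁ τ₂)
    {a₁ u₁ e₁ a₂ u₂ e₂ e₃ e₄ : K} (ha₁ : a₁ ∈ F) (ha₂ : a₂ ∈ F) (hu₁ : u₁ ∈ Fl) (hu₂ : u₂ ∈ Fl)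
    (he₁ : e₁ ∈ Fk) (he₂ : e₂ ∈ Fk) (he₃ : e₃ ∈ Fk) (he₄ : e₄ ∈ Fk)
    (h₁ : a₁ ≠ 0 ∨ u₁ ≠ 0) (h₂ : a₂ ≠ 0 ∨ u₂ ≠ 0)
    (R : ProductRelations φ δ₁ δ₂ τ₁ τ₂ a₁ u₁ e₁ a₂ u₂ e₂ a₁ u₁ e₃ a₂ u₂ e₄) :
    e₃ = e₁ ∨ ∃ s ∈ F, s ≠ 0 ∧ a₂ = s * a₁ ∧ u₂ = s * u₁ ∧ e₄ = s * e₁ := by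
  refine or_iff_not_imp_left.2 fun hne ↦ ?_
  have hd : e₁ - e₃ ≠ 0 := sub_ne_zero.2 (Ne.symm hne)
  have hae : a₁ * e₂ + a₂ * e₁ = a₁ * e₄ + a₂ * e₃ :=
    mul_left_cancel₀ S.τ₁_ne (by linear_combination R.cubic)
  have hue : u₁ * e₂ + u₂ * e₁ = u₁ * e₄ + u₂ * e₃ := by
    apply mul_left_cancel₀ (mul_ne_zero S.δ₁_ne S.τ₁_ne)
    linear_combination R.quartic - τ₂ * congrArg φ hae
  obtain ⟨s, hs⟩ : ∃ s, s = (e₄ - e₂) / (e₁ - e₃) := ⟨_, rfl⟩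
  have hsd : s * (e₁ - e₃) = e₄ - e₂ := by rw [hs, div_mul_cancel₀ _ hd]
  have hsa : a₂ = s * a₁ := mul_right_cancel₀ hd (by linear_combination hae - a₁ * hsd)
  have hsu : u₂ = s * u₁ := mul_right_cancel₀ hd (by linear_combination hue - u₁ * hsd)
  have hsF : s ∈ F := S.scalar_mem ha₁ ha₂ hu₁ hu₂
    (hs ▸ div_mem (sub_mem he₄ he₂) (sub_mem he₁ he₃)) h₁ hsa hsu
  have hs0 : s ≠ 0 := by
    rintro rfl
    simp [hsa, hsu] at h₂
  refine ⟨s, hsF, hs0, hsa, hsu, mul_right_cancel₀ hd ?_⟩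
  linear_combination R.ee - e₁ * hsd

/-- The case where the parts `(a, u)` of the first and third factors vanish. -/
lemma exists_scalar_of_zero (S : SumThreeSetup F Fk Fl L φ γ δ₁ δ₂ τ₁ τ₂)
    {e₁ a₂ u₂ e₂ e₃ a₄ u₄ e₄ : K} (ha₂ : a₂ ∈ F) (hu₂ : u₂ ∈ Fl) (ha₄ : a₄ ∈ F) (hu₄ : u₄ ∈ Fl)
    (he₁ : e₁ ∈ Fk) (he₃ : e₃ ∈ Fk) (h₁ : e₁ ≠ 0) (h₃ : e₃ ≠ 0)
    (h₄ : a₄ ≠ 0 ∨ u₄ ≠ 0 ∨ e₄ ≠ 0)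
    (R : ProductRelations φ δ₁ δ₂ τ₁ τ₂ 0 0 e₁ a₂ u₂ e₂ 0 0 e₃ a₄ u₄ e₄) :
    ∃ c ∈ F, c ≠ 0 ∧ (e₃ = c * e₁ ∨ (a₄ = 0 ∧ u₄ = 0 ∧ e₄ = c * e₁)) := by
  have hae : a₂ * e₁ = a₄ * e₃ :=
    mul_left_cancel₀ S.τ₁_ne (by simpa using R.cubic)
  have hue : u₂ * e₁ = u₄ * e₃ := by
    apply mul_left_cancel₀ (mul_ne_zero S.δ₁_ne S.τ₁_ne)
    have := R.quartic
    simp only [zero_mul, zero_add, hae] at this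
    linear_combination this
  by_cases h : a₄ ≠ 0 ∨ u₄ ≠ 0
  · have hc : e₃ / e₁ ∈ F := S.scalar_mem ha₄ ha₂ hu₄ hu₂ (div_mem he₃ he₁) h
      (by field_simp; linear_combination hae) (by field_simp; linear_combination hue)
    exact ⟨_, hc, div_ne_zero h₃ h₁, .inl (by field_simp)⟩
  · push Not at h
    obtain ⟨ha, hu⟩ := h
    have he₄ : e₄ ≠ 0 := by simpa [ha, hu] using h₄
    obtain ⟨c, hc, hc0, h'⟩ := exists_fixed_scalar_of_twisted_product_eq φ h₁ h₃ he₄ R.ee R.ee_twist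
    exact ⟨c, (S.fixed_iff c).1 hc, hc0, h'.imp_right fun h'' ↦ ⟨ha, hu, h''⟩⟩

/-- The `F`-subspace of all elements `sumThree`. -/
def space (S : SumThreeSetup F Fk Fl L φ γ δ₁ δ₂ τ₁ τ₂) : Submodule F K where
  carrier := {x | ∃ a ∈ F, ∃ u ∈ Fl, ∃ e ∈ Fk, x = sumThree φ γ δ₁ δ₂ τ₁ τ₂ a u e}
  add_mem' := by
    rintro _ _ ⟨a, ha, u, hu, e, he, rfl⟩ ⟨b, hb, v, hv, f, hf, rfl⟩
    refine ⟨a + b, add_mem ha hb, u + v, add_mem hu hv, e + f, add_mem he hf, ?_⟩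
    simp only [sumThree, map_add]
    ring
  zero_mem' := ⟨0, zero_mem _, 0, zero_mem _, 0, zero_mem _, by simp [sumThree]⟩
  smul_mem' := by
    rintro ⟨c, hc⟩ _ ⟨a, ha, u, hu, e, he, rfl⟩
    exact ⟨c * a, mul_mem hc ha, c * u, mul_mem (S.le_l hc) hu, c * e, mul_mem (S.le_k hc) he,
      (sumThree_mul_left ((S.fixed_iff c).2 hc) ..).symm⟩

lemma exists_scalar_of_zero_parts (S : SumThreeSetup F Fk Fl L φ γ δ₁ δ₂ τ₁ τ₂) {e₁ e₃ x₂ x₄ : K}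
    (he₁ : e₁ ∈ Fk) (he₃ : e₃ ∈ Fk) (hx₂ : x₂ ∈ S.space) (hx₄ : x₄ ∈ S.space)
    (h₁ : sumThree φ γ δ₁ δ₂ τ₁ τ₂ 0 0 e₁ ≠ 0) (h₃ : sumThree φ γ δ₁ δ₂ τ₁ τ₂ 0 0 e₃ ≠ 0)
    (h₄ : x₄ ≠ 0)
    (h : sumThree φ γ δ₁ δ₂ τ₁ τ₂ 0 0 e₁ * x₂ = sumThree φ γ δ₁ δ₂ τ₁ τ₂ 0 0 e₃ * x₄) :
    ∃ c ∈ F, c ≠ 0 ∧ (sumThree φ γ δ₁ δ₂ τ₁ τ₂ 0 0 e₃ = c * sumThree φ γ δ₁ δ₂ τ₁ τ₂ 0 0 e₁ ∨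
      x₄ = c * sumThree φ γ δ₁ δ₂ τ₁ τ₂ 0 0 e₁) := by
  obtain ⟨a₂, ha₂, u₂, hu₂, e₂, he₂, rfl⟩ := hx₂
  obtain ⟨a₄, ha₄, u₄, hu₄, e₄, he₄, rfl⟩ := hx₄
  have R := S.productRelations F.zero_mem ha₂ F.zero_mem ha₄ Fl.zero_mem hu₂ Fl.zero_mem hu₄
    he₁ he₂ he₃ he₄ h
  obtain ⟨c, hc, hc0, h'⟩ := S.exists_scalar_of_zero ha₂ hu₂ ha₄ hu₄ he₁ he₃
    (by rintro rfl; simp [sumThree] at h₁) (by rintro rfl; simp [sumThree] at h₃)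
    (by by_contra! h0; obtain ⟨rfl, rfl, rfl⟩ := h0; simp [sumThree] at h₄) R
  have hfix := (S.fixed_iff c).2 hc
  refine ⟨c, hc, hc0, h'.imp ?_ ?_⟩
  · rintro rfl
    simpa using sumThree_mul_left hfix γ δ₁ δ₂ τ₁ τ₂ 0 0 e₁
  · rintro ⟨rfl, rfl, rfl⟩
    simpa using sumThree_mul_left hfix γ δ₁ δ₂ τ₁ τ₂ 0 0 e₁

lemma exists_scalar_of_proportional_parts (S : SumThreeSetup F Fk Fl L φ γ δ₁ δ₂ τ₁ τ₂)
    {a₁ u₁ e₁ a₂ u₂ e₂ e₃ a₄ u₄ e₄ c : K}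
    (ha₁ : a₁ ∈ F) (ha₂ : a₂ ∈ F) (ha₄ : a₄ ∈ F)
    (hu₁ : u₁ ∈ Fl) (hu₂ : u₂ ∈ Fl) (hu₄ : u₄ ∈ Fl)
    (he₁ : e₁ ∈ Fk) (he₂ : e₂ ∈ Fk) (he₃ : e₃ ∈ Fk) (he₄ : e₄ ∈ Fk)
    (h₁ : a₁ ≠ 0 ∨ u₁ ≠ 0) (h₂ : a₂ ≠ 0 ∨ u₂ ≠ 0) (hc : c ∈ F) (hc0 : c ≠ 0)
    (h : sumThree φ γ δ₁ δ₂ τ₁ τ₂ a₁ u₁ e₁ * sumThree φ γ δ₁ δ₂ τ₁ τ₂ a₂ u₂ e₂ =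
      sumThree φ γ δ₁ δ₂ τ₁ τ₂ (c * a₁) (c * u₁) e₃ * sumThree φ γ δ₁ δ₂ τ₁ τ₂ a₄ u₄ e₄) :
    ∃ d ∈ F, d ≠ 0 ∧
      (sumThree φ γ δ₁ δ₂ τ₁ τ₂ (c * a₁) (c * u₁) e₃ = d * sumThree φ γ δ₁ δ₂ τ₁ τ₂ a₁ u₁ e₁ ∨
        sumThree φ γ δ₁ δ₂ τ₁ τ₂ a₄ u₄ e₄ = d * sumThree φ γ δ₁ δ₂ τ₁ τ₂ a₁ u₁ e₁) := by
  have hfix := (S.fixed_iff c).2 hc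
  have R := S.productRelations ha₁ ha₂ (mul_mem hc ha₁) ha₄ hu₁ hu₂ (mul_mem (S.le_l hc) hu₁) hu₄
    he₁ he₂ he₃ he₄ h
  have haa : a₁ * (a₂ - c * a₄) = 0 := by linear_combination R.aa
  have huu : u₁ * (u₂ - c * u₄) = 0 := by linear_combination R.uu
  have hau : a₁ * (u₂ - c * u₄) + u₁ * (a₂ - c * a₄) = 0 := by linear_combination R.au
  obtain ⟨ha, hu⟩ : a₂ = c * a₄ ∧ u₂ = c * u₄ := by
    simp only [← sub_eq_zero (b := c * _)]
    by_cases h0 : a₁ = 0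
    · have hu0 := h₁.resolve_left (not_not.2 h0)
      simp_all
    · simp_all
  subst ha hu
  obtain ⟨f, hf, rfl⟩ : ∃ f ∈ Fk, e₃ = c * f :=
    ⟨c⁻¹ * e₃, mul_mem (inv_mem (S.le_k hc)) he₃, by field_simp⟩
  have hce₄ := mul_mem (S.le_k hc) he₄
  rw [sumThree_mul_left hfix, mul_assoc, mul_left_comm, ← sumThree_mul_left hfix _ _ _ _ _ a₄] at h
  have R' := S.productRelations ha₁ ha₂ ha₁ ha₂ hu₁ hu₂ hu₁ hu₂ he₁ he₂ hf hce₄ h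
  rcases S.exists_scalar_of_eq ha₁ ha₂ hu₁ hu₂ he₁ he₂ hf hce₄ h₁ h₂ R' with
    rfl | ⟨s, hs, hs0, hsa, hsu, hse⟩
  · exact ⟨c, hc, hc0, .inl (sumThree_mul_left hfix ..)⟩
  · refine ⟨c⁻¹ * s, mul_mem (inv_mem hc) hs, mul_ne_zero (inv_ne_zero hc0) hs0, .inr ?_⟩
    apply mul_left_cancel₀ hc0
    rw [← sumThree_mul_left hfix, hsa, hsu, hse, sumThree_mul_left ((S.fixed_iff s).2 hs)]
    field_simp

lemma exists_scalar (S : SumThreeSetup F Fk Fl L φ γ δ₁ δ₂ τ₁ τ₂) {x₁ x₂ x₃ x₄ : K}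
    (hx₁ : x₁ ∈ S.space) (hx₂ : x₂ ∈ S.space) (hx₃ : x₃ ∈ S.space) (hx₄ : x₄ ∈ S.space)
    (h₁ : x₁ ≠ 0) (h₂ : x₂ ≠ 0) (h₃ : x₃ ≠ 0) (h₄ : x₄ ≠ 0) (h : x₁ * x₂ = x₃ * x₄) :
    ∃ c ∈ F, c ≠ 0 ∧ (x₃ = c * x₁ ∨ x₄ = c * x₁) := by
  have symm : (∃ c ∈ F, c ≠ 0 ∧ (x₃ = c * x₂ ∨ x₄ = c * x₂)) →
      ∃ c ∈ F, c ≠ 0 ∧ (x₃ = c * x₁ ∨ x₄ = c * x₁) := by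
    rintro ⟨c, hc, hc0, rfl | rfl⟩
    · exact ⟨c⁻¹, inv_mem hc, inv_ne_zero hc0, .inr ((eq_inv_mul_iff_mul_eq₀ hc0).2
        (mul_right_cancel₀ h₂ (by linear_combination -h)))⟩
    · exact ⟨c⁻¹, inv_mem hc, inv_ne_zero hc0, .inl ((eq_inv_mul_iff_mul_eq₀ hc0).2
        (mul_right_cancel₀ h₂ (by linear_combination -h)))⟩
  have swap : ∀ y, (∃ c ∈ F, c ≠ 0 ∧ (x₄ = c * y ∨ x₃ = c * y)) →
      ∃ c ∈ F, c ≠ 0 ∧ (x₃ = c * y ∨ x₄ = c * y) :=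
    fun y ⟨c, hc, hc0, h⟩ ↦ ⟨c, hc, hc0, h.symm⟩
  have hx₁' := hx₁
  have hx₂' := hx₂
  have hx₃' := hx₃
  have hx₄' := hx₄
  obtain ⟨a₁, ha₁, u₁, hu₁, e₁, he₁, rfl⟩ := hx₁
  obtain ⟨a₂, ha₂, u₂, hu₂, e₂, he₂, rfl⟩ := hx₂
  obtain ⟨a₃, ha₃, u₃, hu₃, e₃, he₃, rfl⟩ := hx₃
  obtain ⟨a₄, ha₄, u₄, hu₄, e₄, he₄, rfl⟩ := hx₄
  have R := S.productRelations ha₁ ha₂ ha₃ ha₄ hu₁ hu₂ hu₃ hu₄ he₁ he₂ he₃ he₄ h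
  by_cases hz : (a₁ = 0 ∧ u₁ = 0) ∨ (a₂ = 0 ∧ u₂ = 0) ∨ (a₃ = 0 ∧ u₃ = 0) ∨ (a₄ = 0 ∧ u₄ = 0)
  · have hz₁₂ : (a₁ = 0 ∧ u₁ = 0) ∨ (a₂ = 0 ∧ u₂ = 0) := by
      rcases hz with h0 | h0 | ⟨rfl, rfl⟩ | ⟨rfl, rfl⟩
      · exact .inl h0
      · exact .inr h0
      all_goals
        refine linear_eq_zero_or_eq_zero (R.aa.trans ?_) (R.au.trans ?_) (R.uu.trans ?_) <;> simp
    have hz₃₄ : (a₃ = 0 ∧ u₃ = 0) ∨ (a₄ = 0 ∧ u₄ = 0) := by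
      rcases hz₁₂ with ⟨rfl, rfl⟩ | ⟨rfl, rfl⟩
      all_goals
        refine linear_eq_zero_or_eq_zero (R.aa.symm.trans ?_) (R.au.symm.trans ?_)
          (R.uu.symm.trans ?_) <;> simp
    rcases hz₁₂ with ⟨rfl, rfl⟩ | ⟨rfl, rfl⟩ <;> rcases hz₃₄ with ⟨rfl, rfl⟩ | ⟨rfl, rfl⟩
    · exact S.exists_scalar_of_zero_parts he₁ he₃ hx₂' hx₄' h₁ h₃ h₄ h
    · exact swap _ (S.exists_scalar_of_zero_parts he₁ he₄ hx₂' hx₃' h₁ h₄ h₃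
        (h.trans (mul_comm ..)))
    · exact symm (S.exists_scalar_of_zero_parts he₂ he₃ hx₁' hx₄' h₂ h₃ h₄
        ((mul_comm ..).trans h))
    · exact symm (swap _ (S.exists_scalar_of_zero_parts he₂ he₄ hx₁' hx₃' h₂ h₄ h₃
        ((mul_comm ..).trans (h.trans (mul_comm ..)))))
  · have hnz : (a₁ ≠ 0 ∨ u₁ ≠ 0) ∧ (a₂ ≠ 0 ∨ u₂ ≠ 0) ∧ (a₃ ≠ 0 ∨ u₃ ≠ 0) ∧
        (a₄ ≠ 0 ∨ u₄ ≠ 0) := by tauto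
    obtain ⟨n₁, n₂, n₃, n₄⟩ := hnz
    have fix : ∀ x ∈ F, φ x = x := fun x hx ↦ (S.fixed_iff x).2 hx
    obtain ⟨c, hc, hc0, ⟨rfl, rfl⟩ | ⟨rfl, rfl⟩⟩ :=
      exists_fixed_scalar_of_linear_product_eq φ (fix _ ha₁) (fix _ ha₂) (fix _ ha₃) (fix _ ha₄)
        n₁ n₃ n₄ R.aa R.au R.uu (by
          rintro rfl rfl rfl rfl
          apply mul_left_cancel₀ (mul_ne_zero S.δ₁_ne S.δ₂_ne)
          linear_combination R.cubic)
    · exact S.exists_scalar_of_proportional_parts ha₁ ha₂ ha₄ hu₁ hu₂ hu₄ he₁ he₂ he₃ he₄ n₁ n₂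
        ((S.fixed_iff c).1 hc) hc0 h
    · exact swap _ (S.exists_scalar_of_proportional_parts ha₁ ha₂ ha₃ hu₁ hu₂ hu₃ he₁ he₂ he₄ he₃
        n₁ n₂ ((S.fixed_iff c).1 hc) hc0 (h.trans (mul_comm ..)))

lemma isSidonSpace_space (S : SumThreeSetup F Fk Fl L φ γ δ₁ δ₂ τ₁ τ₂) :
    IsSidonSpace F S.space := by
  have span_eq : ∀ {c x y : K}, c ∈ F → c ≠ 0 → y = c * x → span F {x} = span F {y} := by
    rintro c x _ hc hc0 rfl
    exact (span_singleton_smul_eq (r := (⟨c, hc⟩ : F))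
      (IsUnit.mk0 _ (by simpa [Subtype.ext_iff] using hc0)) x).symm
  intro x₁ hx₁ x₂ hx₂ x₃ hx₃ x₄ hx₄ h₁ h₂ h₃ h₄ h
  obtain ⟨c, hc, hc0, h' | h'⟩ := S.exists_scalar hx₁ hx₂ hx₃ hx₄ h₁ h₂ h₃ h₄ h
  · rw [span_eq hc hc0 h', span_eq (x := x₄) (y := x₂) hc hc0 (mul_left_cancel₀ h₁ (by
      rw [h, h']
      ring))]
  · rw [span_eq hc hc0 h', span_eq (x := x₃) (y := x₂) hc hc0 (mul_left_cancel₀ h₁ (by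
      rw [h, h']
      ring)), Set.pair_comm]

lemma card_space (S : SumThreeSetup F Fk Fl L φ γ δ₁ δ₂ τ₁ τ₂) :
    Nat.card S.space = Nat.card F * (Nat.card Fl * Nat.card Fk) := by
  rw [← Nat.card_prod, ← Nat.card_prod]
  refine (Nat.card_congr (Equiv.ofBijective (fun t : F × Fl × Fk ↦
    (⟨sumThree φ γ δ₁ δ₂ τ₁ τ₂ t.1 t.2.1 t.2.2,
      t.1, t.1.2, t.2.1, t.2.1.2, t.2.2, t.2.2.2, rfl⟩ : S.space)) ⟨?_, ?_⟩)).symm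
  · rintro ⟨⟨a, ha⟩, ⟨u, hu⟩, ⟨e, he⟩⟩ ⟨⟨b, hb⟩, ⟨v, hv⟩, ⟨f, hf⟩⟩ h
    have h' : sumThree φ γ δ₁ δ₂ τ₁ τ₂ (a - b) (u - v) (e - f) = 0 := by
      rw [← sub_eq_zero.2 (congrArg Subtype.val h)]
      simp only [sumThree, map_sub]
      ring
    simpa [sub_eq_zero] using
      S.eq_zero_of_sumThree_eq_zero (sub_mem ha hb) (sub_mem hu hv) (sub_mem he hf) h'
  · rintro ⟨_, a, ha, u, hu, e, he, rfl⟩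
    exact ⟨(⟨a, ha⟩, ⟨u, hu⟩, ⟨e, he⟩), rfl⟩

end SumThreeSetup

section FiniteField

variable {K : Type*} [Field K] [Finite K]

/-- A subfield of order `m` of a finite field is the set of roots of `X ^ m - X`. -/
lemma Subfield.mem_iff_pow_natCard_eq (E : Subfield K) (x : K) :
    x ∈ E ↔ x ^ Nat.card E = x := by
  have := Fintype.ofFinite E
  rw [Nat.card_eq_fintype_card]
  have hmem : ∀ x ∈ E, x ^ Fintype.card E = x := fun x hx ↦
    congrArg Subtype.val (FiniteField.pow_card (⟨x, hx⟩ : E))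
  refine ⟨hmem x, fun hx ↦ ?_⟩
  have hcard : 1 < Fintype.card E := Fintype.one_lt_card
  have hne : (Polynomial.X ^ Fintype.card E - Polynomial.X : Polynomial K) ≠ 0 :=
    FiniteField.X_pow_card_sub_X_ne_zero K hcard
  by_contra hxE
  have hsub : insert x (E : Set K) ⊆
      (Polynomial.X ^ Fintype.card E - Polynomial.X : Polynomial K).rootSet K := by
    intro y hy
    rw [Polynomial.mem_rootSet]
    refine ⟨hne, ?_⟩
    rcases hy with rfl | hy
    · simp [hx]
    · simp [hmem y hy]
  have h1 := Set.ncard_le_ncard hsub (Set.toFinite _)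
  rw [Set.ncard_insert_of_notMem hxE (Set.toFinite _)] at h1
  have h2 := (Polynomial.X ^ Fintype.card E - Polynomial.X : Polynomial K).ncard_rootSet_le K
  rw [FiniteField.X_pow_card_sub_X_natDegree_eq K hcard] at h2
  have h3 : (E : Set K).ncard = Fintype.card E := Nat.card_eq_fintype_card
  omega

/-- Subfields of coprime degrees over a subfield `F` of order `q` meet in `F`. -/
lemma Subfield.mem_of_mem_of_mem_of_coprime {q k l : ℕ} (hkl : Nat.Coprime k l)
    {F Fk Fl : Subfield K} (hF : Nat.card F = q) (hFk : Nat.card Fk = q ^ k)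
    (hFl : Nat.card Fl = q ^ l) {x : K} (hk : x ∈ Fk) (hl : x ∈ Fl) : x ∈ F := by
  rw [Subfield.mem_iff_pow_natCard_eq] at hk hl ⊢
  have periodic : ∀ m, x ^ q ^ m = x → Function.IsPeriodicPt (· ^ q) m x := by
    intro m hm
    rwa [Function.IsPeriodicPt, Function.IsFixedPt, pow_iterate]
  have := (periodic k (hFk ▸ hk)).gcd (periodic l (hFl ▸ hl))
  rw [hkl.gcd_eq_one] at this
  simpa [hF, Function.IsPeriodicPt, Function.IsFixedPt] using this

end FiniteField

/-- Powers of `γ` below the degree of its minimal polynomial satisfy no linear relation. -/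
lemma eq_zero_of_sum_pow_eq_zero {K : Type*} [Field K] {L : Subfield K} {γ : K} {m : ℕ}
    (hm : m ≤ (minpoly L γ).natDegree) (c : Fin m → K) (hc : ∀ i, c i ∈ L)
    (h : ∑ i, c i * γ ^ (i : ℕ) = 0) (i : Fin m) : c i = 0 := by
  have hli := (linearIndependent_pow (K := L) γ).comp (Fin.castLE hm) (Fin.castLE_injective hm)
  have := Fintype.linearIndependent_iff.1 hli (fun i ↦ ⟨c i, hc i⟩)
    (by simpa [Subfield.smul_def] using h) i
  exact congrArg Subtype.val this

/-- For `kl ∣ n`, `gcd(k,l) = 1`, `γ` a root of an irreducible polynomial of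
degree `n/(kl) > 8` over `F_{q^{kl}}`, `δ₁, δ₂ ∈ F_{q^l}^*`, `τ₁, τ₂ ∈ F_{q^k}^*`, the set
`U = {a + δ₁uγ + δ₂uᑫγ² + τ₁eγ³ + τ₂eᑫγ⁴ : a ∈ F_q, u ∈ F_{q^l}, e ∈ F_{q^k}}` is a
Sidon space of dimension `k + l + 1`. -/
theorem sidonSpace_sum_three {K : Type*} [Field K] (q n k l : ℕ)
    (hq : IsPrimePow q) (hn : 0 < n) (hk : 0 < k) (hl : 0 < l)
    (hkl : Nat.Coprime k l) (hkln : k * l ∣ n)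
    (hK : Nat.card K = q ^ n)
    (F : Subfield K) (hF : Nat.card F = q)
    (Fk : Subfield K) (hFk : Nat.card Fk = q ^ k) (hFFk : F ≤ Fk)
    (Fl : Subfield K) (hFl : Nat.card Fl = q ^ l) (hFFl : F ≤ Fl)
    (Fkl : Subfield K) (hFkl : Nat.card Fkl = q ^ (k * l))
    (hFkFkl : Fk ≤ Fkl) (hFlFkl : Fl ≤ Fkl)
    (γ : K) (hγ : γ ≠ 0)
    (hdeg : (minpoly Fkl γ).natDegree = n / (k * l)) (hdeg8 : 8 < n / (k * l))
    (δ₁ δ₂ : K) (hδ₁ : δ₁ ∈ Fl) (hδ₂ : δ₂ ∈ Fl) (hδ₁0 : δ₁ ≠ 0) (hδ₂0 : δ₂ ≠ 0)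
    (τ₁ τ₂ : K) (hτ₁ : τ₁ ∈ Fk) (hτ₂ : τ₂ ∈ Fk) (hτ₁0 : τ₁ ≠ 0) (hτ₂0 : τ₂ ≠ 0) :
    IsSidonSpace F
        (Submodule.span F
          {x : K | ∃ a ∈ F, ∃ u ∈ Fl, ∃ e ∈ Fk,
            x = a + δ₁ * u * γ + δ₂ * u ^ q * γ ^ 2
              + τ₁ * e * γ ^ 3 + τ₂ * e ^ q * γ ^ 4}) ∧
      Module.finrank F
        ↥(Submodule.span F
          {x : K | ∃ a ∈ F, ∃ u ∈ Fl, ∃ e ∈ Fk,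
            x = a + δ₁ * u * γ + δ₂ * u ^ q * γ ^ 2
              + τ₁ * e * γ ^ 3 + τ₂ * e ^ q * γ ^ 4}) = k + l + 1 := by
  have hcardK : Nat.card K ≠ 0 := hK ▸ pow_ne_zero n hq.ne_zero
  have : Finite K := Nat.finite_of_card_ne_zero hcardK
  have := Fintype.ofFinite F
  have hqF : Fintype.card F = q := by rw [← Nat.card_eq_fintype_card, hF]
  obtain ⟨φ, hφ⟩ : ∃ φ : K →+* K, ∀ x, φ x = x ^ q :=
    ⟨(FiniteField.frobeniusAlgHom F K).toRingHom, fun x ↦ by simp [hqF]⟩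
  have S : SumThreeSetup F Fk Fl Fkl φ γ δ₁ δ₂ τ₁ τ₂ :=
    { fixed_iff := fun x ↦ by rw [hφ, F.mem_iff_pow_natCard_eq, hF]
      map_mem_k := fun x hx ↦ hφ x ▸ pow_mem hx q
      map_mem_l := fun x hx ↦ hφ x ▸ pow_mem hx q
      le_k := hFFk
      le_l := hFFl
      k_le := hFkFkl
      l_le := hFlFkl
      inf_le := fun x ↦ Subfield.mem_of_mem_of_mem_of_coprime hkl hF hFk hFl
      indep := eq_zero_of_sum_pow_eq_zero (hdeg ▸ hdeg8)
      δ₁_mem := hδ₁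
      δ₂_mem := hδ₂
      δ₁_ne := hδ₁0
      δ₂_ne := hδ₂0
      τ₁_mem := hτ₁
      τ₂_mem := hτ₂
      τ₁_ne := hτ₁0
      τ₂_ne := hτ₂0 }
  have hspan : Submodule.span F
      {x : K | ∃ a ∈ F, ∃ u ∈ Fl, ∃ e ∈ Fk,
        x = a + δ₁ * u * γ + δ₂ * u ^ q * γ ^ 2
          + τ₁ * e * γ ^ 3 + τ₂ * e ^ q * γ ^ 4} = S.space := by
    rw [← Submodule.span_eq S.space]
    congr 1
    simp only [← hφ]
    rfl
  rw [hspan]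
  refine ⟨S.isSidonSpace_space, Nat.pow_right_injective hq.two_le ?_⟩
  have h := S.card_space
  rw [Module.natCard_eq_pow_finrank (K := F), hF, hFl, hFk] at h
  simp only [h]
  ring
end

section
/- Let q be a prime power and n, k, l, s positive integers with kls | n and k, l, s pairwise relatively prime. Let γ ∈ F_{q^n}^* be a root of an irreducible polynomial of degree n/(kls) over F_{q^{kls}}, where n/(kls) > 12, and let δ_1, δ_2 ∈ F_{q^l}^*, τ_1, τ_2 ∈ F_{q^k}^*, η_1, η_2 ∈ F_{q^s}^*. Then U = {δ_1 a + δ_2 a^q γ + τ_1 u γ^3 + τ_2 u^q γ^4 + η_1 e γ^5 + η_2 e^q γ^6 : a ∈ F_{q^l}, u ∈ F_{q^k}, e ∈ F_{q^s}} is a Sidon space of F_q-dimension k + l + s. -/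
open Submodule Pointwise

set_option maxHeartbeats 1000000
set_option synthInstance.maxHeartbeats 400000

/-- Two factorisations of a ternary quadratic form into linear forms, one of whose factors has a
nonzero first coefficient, agree up to order and a scalar. -/
theorem linearForms_unique_of_ne_zero {K : Type*} [Field K]
    {a u e b v f c w g d x h : K} (ha : a ≠ 0)
    (h1 : a * b = c * d) (h2 : u * v = w * x) (h3 : e * f = g * h)
    (h12 : a * v + b * u = c * x + d * w) (h13 : a * f + b * e = c * h + d * g)
    (h23 : u * f + v * e = w * h + x * g) :
    (∃ r, c = r * a ∧ w = r * u ∧ g = r * e ∧ b = r * d ∧ v = r * x ∧ f = r * h) ∨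
      (∃ r, d = r * a ∧ x = r * u ∧ h = r * e ∧ b = r * c ∧ v = r * w ∧ f = r * g) := by
  have hcancel : ∀ {c w g d x h : K}, a * b = c * d → a * v + b * u = c * x + d * w →
      a * f + b * e = c * h + d * g → w * a - c * u = 0 → g * a - c * e = 0 →
      ∃ r, c = r * a ∧ w = r * u ∧ g = r * e ∧ b = r * d ∧ v = r * x ∧ f = r * h := by
    intro c w g d x h h1 h12 h13 hw hg
    have hc : c = c / a * a := by field_simp
    have hw' : w = c / a * u := by field_simp; linear_combination hw
    have hg' : g = c / a * e := by field_simp; linear_combination hg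
    generalize c / a = r at hc hw' hg'
    subst hc hw' hg'
    have hb : b = r * d := mul_left_cancel₀ ha (by linear_combination h1)
    subst hb
    exact ⟨r, rfl, rfl, rfl, rfl, mul_left_cancel₀ ha (by linear_combination h12),
      mul_left_cancel₀ ha (by linear_combination h13)⟩
  have hj : (w * a - c * u) * (x * a - d * u) = 0 := by
    linear_combination (-a ^ 2) * h2 + a * u * h12 - u ^ 2 * h1
  have hk : (g * a - c * e) * (h * a - d * e) = 0 := by
    linear_combination (-a ^ 2) * h3 + a * e * h13 - e ^ 2 * h1
  have hjk : (w * a - c * u) * (h * a - d * e) + (g * a - c * e) * (x * a - d * u) = 0 := by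
    linear_combination (-a ^ 2) * h23 + a * u * h13 + a * e * h12 - 2 * u * e * h1
  have hor : (w * a - c * u = 0 ∧ g * a - c * e = 0) ∨ (x * a - d * u = 0 ∧ h * a - d * e = 0) := by
    clear hcancel h1 h2 h3 h12 h13 h23
    generalize w * a - c * u = A at *
    generalize g * a - c * e = B at *
    generalize x * a - d * u = C at *
    generalize h * a - d * e = D at *
    grind
  rcases hor with ⟨hw, hg⟩ | ⟨hx, hh⟩
  · exact Or.inl (hcancel h1 h12 h13 hw hg)
  · exact Or.inr (hcancel (by rw [h1, mul_comm]) (by rw [h12, add_comm]) (by rw [h13, add_comm]) hx hh)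

/-- A factorisation of a nonzero ternary quadratic form into two linear forms is unique up to order
and a scalar. -/
theorem linearForms_unique {K : Type*} [Field K]
    {a u e b v f c w g d x h : K} (hp : ¬ (a = 0 ∧ u = 0 ∧ e = 0))
    (h1 : a * b = c * d) (h2 : u * v = w * x) (h3 : e * f = g * h)
    (h12 : a * v + b * u = c * x + d * w) (h13 : a * f + b * e = c * h + d * g)
    (h23 : u * f + v * e = w * h + x * g) :
    (∃ r, c = r * a ∧ w = r * u ∧ g = r * e ∧ b = r * d ∧ v = r * x ∧ f = r * h) ∨
      (∃ r, d = r * a ∧ x = r * u ∧ h = r * e ∧ b = r * c ∧ v = r * w ∧ f = r * g) := by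
  by_cases ha : a = 0
  · by_cases hu : u = 0
    · have he : e ≠ 0 := fun he => hp ⟨ha, hu, he⟩
      rcases linearForms_unique_of_ne_zero he h3 h1 h2 (by linear_combination h13)
        (by linear_combination h23) h12 with ⟨r, h⟩ | ⟨r, h⟩
      · exact Or.inl ⟨r, by tauto⟩
      · exact Or.inr ⟨r, by tauto⟩
    · rcases linearForms_unique_of_ne_zero hu h2 h1 h3 (by linear_combination h12)
        h23 h13 with ⟨r, h⟩ | ⟨r, h⟩
      · exact Or.inl ⟨r, by tauto⟩
      · exact Or.inr ⟨r, by tauto⟩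
  · exact linearForms_unique_of_ne_zero ha h1 h2 h3 h12 h13 h23

/-- If `(r a)` and `(r d)` have the same symmetrised twisted product as `a` and `d` with the scalar
moved to the other factor, then `r` or `d / a` is fixed by the twist. -/
theorem fixed_or_proportional {K : Type*} [Field K] (φ : K →+* K) {r a d : K}
    (ha : a ≠ 0)
    (H : a * φ (r * d) + φ a * (r * d) = r * a * φ d + φ (r * a) * d) :
    φ r = r ∨ ∃ m, φ m = m ∧ d = m * a := by
  simp only [map_mul] at H
  have hz : (φ r - r) * (a * φ d - φ a * d) = 0 := by linear_combination H
  rcases mul_eq_zero.1 hz with h | h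
  · exact Or.inl (sub_eq_zero.1 h)
  · refine Or.inr ⟨d / a, ?_, by field_simp⟩
    have : φ a ≠ 0 := by simpa using ha
    rw [map_div₀]
    field_simp
    linear_combination h

/-- The scalar relating two factorisations can be taken in the fixed field, after possibly
exchanging the factors. -/
theorem exists_fixed_scalar {K : Type*} [Field K] (φ : K →+* K) (Fl Fk Fs : Subfield K)
    (hlk : ∀ y ∈ Fl, y ∈ Fk → φ y = y) (hls : ∀ y ∈ Fl, y ∈ Fs → φ y = y)
    (hks : ∀ y ∈ Fk, y ∈ Fs → φ y = y)
    {a u e b v f c w g d x h r : K}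
    (ha : a ∈ Fl) (hb : b ∈ Fl) (hc : c ∈ Fl) (hd : d ∈ Fl)
    (hu : u ∈ Fk) (hv : v ∈ Fk) (hw : w ∈ Fk) (hx : x ∈ Fk)
    (he : e ∈ Fs) (hf : f ∈ Fs) (hg : g ∈ Fs) (hh : h ∈ Fs)
    (hp : ¬ (a = 0 ∧ u = 0 ∧ e = 0)) (ht : ¬ (d = 0 ∧ x = 0 ∧ h = 0))
    (H1 : a * φ b + φ a * b = c * φ d + φ c * d)
    (H2 : u * φ v + φ u * v = w * φ x + φ w * x)
    (H3 : e * φ f + φ e * f = g * φ h + φ g * h)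
    (h1 : c = r * a) (h2 : w = r * u) (h3 : g = r * e)
    (h4 : b = r * d) (h5 : v = r * x) (h6 : f = r * h) :
    φ r = r ∨ ∃ m, φ m = m ∧ d = m * a ∧ x = m * u ∧ h = m * e ∧ b = m * c ∧ v = m * w ∧
      f = m * g := by
  have mem : ∀ {L : Subfield K} {a b c d : K}, a ∈ L → b ∈ L → c ∈ L → d ∈ L → c = r * a →
      b = r * d → (a ≠ 0 ∨ d ≠ 0) → r ∈ L := by
    intro L a b c d ha hb hc hd h1 h4 hor
    rcases hor with h | h
    · rw [eq_div_of_mul_eq h h1.symm]; exact div_mem hc ha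
    · rw [eq_div_of_mul_eq h h4.symm]; exact div_mem hb hd
  have ml := mem ha hb hc hd h1 h4
  have mk := mem hu hv hw hx h2 h5
  have ms := mem he hf hg hh h3 h6
  subst h1 h2 h3 h4 h5 h6
  by_cases hl : a ≠ 0 ∨ d ≠ 0 <;> by_cases hk : u ≠ 0 ∨ x ≠ 0 <;> by_cases hs : e ≠ 0 ∨ h ≠ 0
  · exact Or.inl (hlk r (ml hl) (mk hk))
  · exact Or.inl (hlk r (ml hl) (mk hk))
  · exact Or.inl (hls r (ml hl) (ms hs))
  · push Not at hk hs
    obtain ⟨⟨rfl, rfl⟩, rfl, rfl⟩ := And.intro hk hs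
    refine (fixed_or_proportional φ (by simpa using hp) H1).imp_right ?_
    rintro ⟨m, hm, rfl⟩
    exact ⟨m, hm, by simp; ring⟩
  · exact Or.inl (hks r (mk hk) (ms hs))
  · push Not at hl hs
    obtain ⟨⟨rfl, rfl⟩, rfl, rfl⟩ := And.intro hl hs
    refine (fixed_or_proportional φ (by simpa using hp) H2).imp_right ?_
    rintro ⟨m, hm, rfl⟩
    exact ⟨m, hm, by simp; ring⟩
  · push Not at hl hk
    obtain ⟨⟨rfl, rfl⟩, rfl, rfl⟩ := And.intro hl hk
    refine (fixed_or_proportional φ (by simpa using hp) H3).imp_right ?_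
    rintro ⟨m, hm, rfl⟩
    exact ⟨m, hm, by simp; ring⟩
  · push Not at hl hk hs
    exact absurd ⟨hl.1, hk.1, hs.1⟩ hp

/-- Powers of `γ` below the degree of its minimal polynomial over `L` are `L`-independent. -/
theorem coeff_eq_zero_of_sum_pow_eq_zero {K : Type*} [Field K] (L : Subfield K) (γ : K) {N : ℕ}
    (hN : N ≤ (minpoly L γ).natDegree) (c : Fin N → K) (hc : ∀ i, c i ∈ L)
    (h : ∑ i, c i * γ ^ (i : ℕ) = 0) (i : Fin N) : c i = 0 := by
  have hli := (linearIndependent_pow (K := L) γ).comp (Fin.castLE hN) (Fin.castLE_injective hN)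
  have := Fintype.linearIndependent_iff.1 hli (fun i => ⟨c i, hc i⟩) (by
    simpa [Subfield.smul_def] using h) i
  simpa using congrArg Subtype.val this

/-- Every fixed point of `x ↦ x ^ q` lies in the subfield with `q` elements. -/
theorem mem_subfield_of_pow_card {K : Type*} [Field K] (F : Subfield K) [Fintype F] {y : K}
    (hy : y ^ Fintype.card F = y) : y ∈ F := by
  have hr := FiniteField.roots_X_pow_card_sub_X F
  have h0 := FiniteField.X_pow_card_sub_X_ne_zero K (Fintype.one_lt_card (α := F))
  have hsplit : (Polynomial.X ^ Fintype.card F - Polynomial.X : Polynomial F).roots.card =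
      (Polynomial.X ^ Fintype.card F - Polynomial.X : Polynomial F).natDegree := by
    rw [hr, FiniteField.X_pow_card_sub_X_natDegree_eq F Fintype.one_lt_card]
    simp
  have hmap := Polynomial.roots_map_of_injective_of_card_eq_natDegree F.subtype.injective hsplit
  have hmem : y ∈ (Polynomial.map F.subtype
      (Polynomial.X ^ Fintype.card F - Polynomial.X)).roots := by
    simp only [Polynomial.map_sub, Polynomial.map_pow, Polynomial.map_X]
    simp [Polynomial.mem_roots h0, hy]
  rw [← hmap, Multiset.mem_map] at hmem
  obtain ⟨z, -, rfl⟩ := hmem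
  exact z.2

/-- An element of two finite fields of coprime degrees over the field with `q` elements is fixed by
`x ↦ x ^ q`. -/
theorem pow_eq_self_of_mem_of_mem {K : Type*} [Field K] {q k l : ℕ} (hkl : Nat.Coprime k l)
    {A B : Subfield K} [Finite A] [Finite B] (hA : Nat.card A = q ^ k) (hB : Nat.card B = q ^ l)
    {y : K} (hyA : y ∈ A) (hyB : y ∈ B) : y ^ q = y := by
  have key : ∀ {L : Subfield K} [Finite L] {m : ℕ}, Nat.card L = q ^ m → y ∈ L →
      Function.IsPeriodicPt (· ^ q) m y := by
    intro L _ m hL hy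
    have := Fintype.ofFinite L
    have h := congrArg Subtype.val (FiniteField.pow_card (⟨y, hy⟩ : L))
    rw [Fintype.card_eq_nat_card, hL] at h
    rw [Function.IsPeriodicPt, Function.IsFixedPt, pow_iterate]
    exact h
  have h := (key hA hyA).gcd (key hB hyB)
  rw [hkl] at h
  exact h

/-- Comparing coefficients in an equality of two products of elements of the form
`δ₁ a + δ₂ φ(a) γ + τ₁ u γ³ + τ₂ φ(u) γ⁴ + η₁ e γ⁵ + η₂ φ(e) γ⁶`. -/
theorem coeffs_of_mul_eq {K : Type*} [Field K] (φ : K →+* K) (L : Subfield K)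
    (hφ : ∀ y ∈ L, φ y ∈ L) {γ : K} (hdeg : 13 ≤ (minpoly L γ).natDegree)
    {δ₁ δ₂ τ₁ τ₂ η₁ η₂ : K} (hδ₁ : δ₁ ∈ L) (hδ₂ : δ₂ ∈ L) (hτ₁ : τ₁ ∈ L) (hτ₂ : τ₂ ∈ L)
    (hη₁ : η₁ ∈ L) (hη₂ : η₂ ∈ L)
    (hδ₁0 : δ₁ ≠ 0) (hδ₂0 : δ₂ ≠ 0) (hτ₁0 : τ₁ ≠ 0) (hτ₂0 : τ₂ ≠ 0) (hη₁0 : η₁ ≠ 0) (hη₂0 : η₂ ≠ 0)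
    {a u e b v f c w g d x h : K}
    (ha : a ∈ L) (hu : u ∈ L) (he : e ∈ L) (hb : b ∈ L) (hv : v ∈ L) (hf : f ∈ L)
    (hc : c ∈ L) (hw : w ∈ L) (hg : g ∈ L) (hd : d ∈ L) (hx : x ∈ L) (hh : h ∈ L)
    (H : (δ₁ * a + δ₂ * φ a * γ + τ₁ * u * γ ^ 3 + τ₂ * φ u * γ ^ 4
          + η₁ * e * γ ^ 5 + η₂ * φ e * γ ^ 6) *
        (δ₁ * b + δ₂ * φ b * γ + τ₁ * v * γ ^ 3 + τ₂ * φ v * γ ^ 4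
          + η₁ * f * γ ^ 5 + η₂ * φ f * γ ^ 6) =
        (δ₁ * c + δ₂ * φ c * γ + τ₁ * w * γ ^ 3 + τ₂ * φ w * γ ^ 4
          + η₁ * g * γ ^ 5 + η₂ * φ g * γ ^ 6) *
        (δ₁ * d + δ₂ * φ d * γ + τ₁ * x * γ ^ 3 + τ₂ * φ x * γ ^ 4
          + η₁ * h * γ ^ 5 + η₂ * φ h * γ ^ 6)) :
    (a * b = c * d ∧ u * v = w * x ∧ e * f = g * h ∧
      a * v + b * u = c * x + d * w ∧ a * f + b * e = c * h + d * g ∧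
      u * f + v * e = w * h + x * g) ∧
    a * φ b + φ a * b = c * φ d + φ c * d ∧
    u * φ v + φ u * v = w * φ x + φ w * x ∧
    e * φ f + φ e * f = g * φ h + φ g * h := by
  have ha' := hφ a ha
  have hu' := hφ u hu
  have he' := hφ e he
  have hb' := hφ b hb
  have hv' := hφ v hv
  have hf' := hφ f hf
  have hc' := hφ c hc
  have hw' := hφ w hw
  have hg' := hφ g hg
  have hd' := hφ d hd
  have hx' := hφ x hx
  have hh' := hφ h hh
  have h0 := coeff_eq_zero_of_sum_pow_eq_zero L γ hdeg
    ![δ₁ * δ₁ * (a * b - c * d),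
      δ₁ * δ₂ * (a * φ b + φ a * b - (c * φ d + φ c * d)),
      δ₂ * δ₂ * (φ a * φ b - φ c * φ d),
      δ₁ * τ₁ * (a * v + b * u - (c * x + d * w)),
      δ₁ * τ₂ * (a * φ v + b * φ u - (c * φ x + d * φ w)) +
        δ₂ * τ₁ * (φ a * v + φ b * u - (φ c * x + φ d * w)),
      δ₂ * τ₂ * (φ a * φ v + φ b * φ u - (φ c * φ x + φ d * φ w)) +
        δ₁ * η₁ * (a * f + b * e - (c * h + d * g)),
      τ₁ * τ₁ * (u * v - w * x) + δ₁ * η₂ * (a * φ f + b * φ e - (c * φ h + d * φ g)) +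
        δ₂ * η₁ * (φ a * f + φ b * e - (φ c * h + φ d * g)),
      τ₁ * τ₂ * (u * φ v + φ u * v - (w * φ x + φ w * x)) +
        δ₂ * η₂ * (φ a * φ f + φ b * φ e - (φ c * φ h + φ d * φ g)),
      τ₂ * τ₂ * (φ u * φ v - φ w * φ x) + τ₁ * η₁ * (u * f + v * e - (w * h + x * g)),
      τ₁ * η₂ * (u * φ f + v * φ e - (w * φ h + x * φ g)) +
        τ₂ * η₁ * (φ u * f + φ v * e - (φ w * h + φ x * g)),
      τ₂ * η₂ * (φ u * φ f + φ v * φ e - (φ w * φ h + φ x * φ g)) +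
        η₁ * η₁ * (e * f - g * h),
      η₁ * η₂ * (e * φ f + φ e * f - (g * φ h + φ g * h)),
      η₂ * η₂ * (φ e * φ f - φ g * φ h)]
    (by
      intro i
      fin_cases i <;> simp only [Fin.reduceFinMk, Fin.zero_eta, Fin.mk_one, Matrix.cons_val] <;>
        repeat' first | assumption | apply add_mem | apply sub_mem | apply mul_mem)
    (by
      simp only [Fin.sum_univ_succ, Fin.sum_univ_zero, Matrix.cons_val_zero, Matrix.cons_val_succ,
        Fin.val_zero, Fin.val_succ]
      linear_combination H)
  have c0 := h0 0
  have c1 := h0 1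
  have c3 := h0 3
  have c5 := h0 5
  have c7 := h0 7
  have c8 := h0 8
  have c10 := h0 10
  have c11 := h0 11
  have c12 := h0 12
  clear h0
  simp only [Matrix.cons_val, ← map_mul, ← map_add, ← map_sub] at c0 c1 c3 c5 c7 c8 c10 c11 c12
  simp only [mul_eq_zero, map_eq_zero, hδ₁0, hδ₂0, hη₁0, hη₂0, hτ₁0, false_or, sub_eq_zero]
    at c0 c1 c3 c11 c12
  rw [c3] at c5
  simp only [sub_self, map_zero, mul_zero, zero_add, mul_eq_zero, hδ₁0, hη₁0, false_or,
    sub_eq_zero] at c5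
  rw [c5] at c7
  simp only [sub_self, map_zero, mul_zero, add_zero, mul_eq_zero, hτ₁0, hτ₂0, false_or,
    sub_eq_zero] at c7
  rw [c12] at c10
  simp only [sub_self, mul_zero, add_zero, mul_eq_zero, map_eq_zero, hη₂0, hτ₂0, false_or,
    sub_eq_zero] at c10
  rw [c10] at c8
  simp only [sub_self, mul_zero, add_zero, mul_eq_zero, map_eq_zero, hτ₂0, false_or,
    sub_eq_zero] at c8
  exact ⟨⟨c0, c8, c12, c3, c5, c10⟩, c1, c7, c11⟩

/-- The span of a nonzero element is not changed by a nonzero scalar in the subfield. -/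
theorem span_singleton_mul_eq {K : Type*} [Field K] (F : Subfield K) {m y z : K} (hm : m ∈ F)
    (hz : z ≠ 0) (h : z = m * y) : Submodule.span F {z} = Submodule.span F {y} := by
  have hm0 : m ≠ 0 := by rintro rfl; simp [h] at hz
  have hu : IsUnit (⟨m, hm⟩ : F) := by
    rw [isUnit_iff_ne_zero]
    exact fun h0 => hm0 (congrArg Subtype.val h0)
  rw [h]
  exact Submodule.span_singleton_smul_eq hu y


/-- For `kls ∣ n` with `k, l, s` pairwise coprime and `γ` a root of an
irreducible polynomial of degree `n/(kls) > 12` over `F_{q^{kls}}`, the indicated set is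
a Sidon space of dimension `k + l + s`. -/
theorem sidonSpace_sum_three_nontrivial_13 {K : Type*} [Field K] (q n k l s : ℕ)
    (hq : IsPrimePow q) (hn : 0 < n) (hk : 0 < k) (hl : 0 < l) (hs : 0 < s)
    (hkl : Nat.Coprime k l) (hks : Nat.Coprime k s) (hls : Nat.Coprime l s)
    (hkls : k * l * s ∣ n)
    (hK : Nat.card K = q ^ n)
    (F : Subfield K) (hF : Nat.card F = q)
    (Fk : Subfield K) (hFk : Nat.card Fk = q ^ k) (hFFk : F ≤ Fk)
    (Fl : Subfield K) (hFl : Nat.card Fl = q ^ l) (hFFl : F ≤ Fl)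
    (Fs : Subfield K) (hFs : Nat.card Fs = q ^ s) (hFFs : F ≤ Fs)
    (Fkls : Subfield K) (hFkls : Nat.card Fkls = q ^ (k * l * s))
    (hFkFkls : Fk ≤ Fkls) (hFlFkls : Fl ≤ Fkls) (hFsFkls : Fs ≤ Fkls)
    (γ : K) (hγ : γ ≠ 0)
    (hdeg : (minpoly Fkls γ).natDegree = n / (k * l * s)) (hdeg12 : 12 < n / (k * l * s))
    (δ₁ δ₂ : K) (hδ₁ : δ₁ ∈ Fl) (hδ₂ : δ₂ ∈ Fl) (hδ₁0 : δ₁ ≠ 0) (hδ₂0 : δ₂ ≠ 0)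
    (τ₁ τ₂ : K) (hτ₁ : τ₁ ∈ Fk) (hτ₂ : τ₂ ∈ Fk) (hτ₁0 : τ₁ ≠ 0) (hτ₂0 : τ₂ ≠ 0)
    (η₁ η₂ : K) (hη₁ : η₁ ∈ Fs) (hη₂ : η₂ ∈ Fs) (hη₁0 : η₁ ≠ 0) (hη₂0 : η₂ ≠ 0) :
    IsSidonSpace F
        (Submodule.span F
          {x : K | ∃ a ∈ Fl, ∃ u ∈ Fk, ∃ e ∈ Fs,
            x = δ₁ * a + δ₂ * a ^ q * γ + τ₁ * u * γ ^ 3 + τ₂ * u ^ q * γ ^ 4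
              + η₁ * e * γ ^ 5 + η₂ * e ^ q * γ ^ 6}) ∧
      Module.finrank F
        ↥(Submodule.span F
          {x : K | ∃ a ∈ Fl, ∃ u ∈ Fk, ∃ e ∈ Fs,
            x = δ₁ * a + δ₂ * a ^ q * γ + τ₁ * u * γ ^ 3 + τ₂ * u ^ q * γ ^ 4
              + η₁ * e * γ ^ 5 + η₂ * e ^ q * γ ^ 6}) = k + l + s := by
  have hq1 : 1 < q := hq.one_lt
  have hq0 : 0 < q := hq.pos
  have : Finite K := Nat.finite_of_card_ne_zero (by rw [hK]; positivity)
  have := Fintype.ofFinite F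
  let Φ : K →ₐ[F] K := FiniteField.frobeniusAlgHom F K
  let φ : K →+* K := Φ.toRingHom
  have hφ : ∀ y, y ^ q = φ y := by
    intro y
    change y ^ q = Φ y
    rw [FiniteField.coe_frobeniusAlgHom, Fintype.card_eq_nat_card, hF]
  have hfix : ∀ {y}, φ y = y → y ∈ F := by
    intro y hy
    apply mem_subfield_of_pow_card F
    rw [Fintype.card_eq_nat_card, hF, hφ, hy]
  have hφF : ∀ {y}, y ∈ F → φ y = y := fun {y} hy => Φ.commutes ⟨y, hy⟩
  have hφL : ∀ (L : Subfield K), ∀ y ∈ L, φ y ∈ L := by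
    intro L y hy
    rw [← hφ]
    exact pow_mem hy q
  let P : K → K → K → K := fun a u e => δ₁ * a + δ₂ * φ a * γ + τ₁ * u * γ ^ 3 + τ₂ * φ u * γ ^ 4
    + η₁ * e * γ ^ 5 + η₂ * φ e * γ ^ 6
  have hPmul : ∀ {m}, φ m = m → ∀ a u e, P (m * a) (m * u) (m * e) = m * P a u e := by
    intro m hm a u e
    simp only [P, map_mul, hm]
    ring
  let V : Submodule F K :=
    { carrier := {x | ∃ a ∈ Fl, ∃ u ∈ Fk, ∃ e ∈ Fs, x = P a u e}
      zero_mem' := ⟨0, zero_mem _, 0, zero_mem _, 0, zero_mem _, by simp [P]⟩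
      add_mem' := by
        rintro _ _ ⟨a, ha, u, hu, e, he, rfl⟩ ⟨b, hb, v, hv, f, hf, rfl⟩
        refine ⟨a + b, add_mem ha hb, u + v, add_mem hu hv, e + f, add_mem he hf, ?_⟩
        simp only [P, map_add]
        ring
      smul_mem' := by
        rintro ⟨m, hm⟩ _ ⟨a, ha, u, hu, e, he, rfl⟩
        exact ⟨m * a, mul_mem (hFFl hm) ha, m * u, mul_mem (hFFk hm) hu,
          m * e, mul_mem (hFFs hm) he, (hPmul (hφF hm) a u e).symm⟩ }
  have hspan : Submodule.span F
      {x : K | ∃ a ∈ Fl, ∃ u ∈ Fk, ∃ e ∈ Fs,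
        x = δ₁ * a + δ₂ * a ^ q * γ + τ₁ * u * γ ^ 3 + τ₂ * u ^ q * γ ^ 4
          + η₁ * e * γ ^ 5 + η₂ * e ^ q * γ ^ 6} = V := by
    simp only [hφ]
    exact Submodule.span_eq V
  rw [hspan]
  rw [← hdeg] at hdeg12
  have hP0 : P 0 0 0 = 0 := by simp [P]
  constructor
  · rintro _ ⟨a, ha, u, hu, e, he, rfl⟩ _ ⟨b, hb, v, hv, f, hf, rfl⟩
      _ ⟨c, hc, w, hw, g, hg, rfl⟩ _ ⟨d, hd, x, hx, h, hh, rfl⟩ hp hr hs' ht H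
    obtain ⟨⟨h1, h2, h3, h12, h13, h23⟩, H1, H2, H3⟩ := coeffs_of_mul_eq φ Fkls (hφL _) hdeg12
      (hFlFkls hδ₁) (hFlFkls hδ₂) (hFkFkls hτ₁) (hFkFkls hτ₂) (hFsFkls hη₁) (hFsFkls hη₂)
      hδ₁0 hδ₂0 hτ₁0 hτ₂0 hη₁0 hη₂0
      (hFlFkls ha) (hFkFkls hu) (hFsFkls he) (hFlFkls hb) (hFkFkls hv) (hFsFkls hf)
      (hFlFkls hc) (hFkFkls hw) (hFsFkls hg) (hFlFkls hd) (hFkFkls hx) (hFsFkls hh) H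
    have hne : ∀ {a u e}, P a u e ≠ 0 → ¬ (a = 0 ∧ u = 0 ∧ e = 0) := by
      rintro a u e h ⟨rfl, rfl, rfl⟩
      exact h hP0
    have hlk : ∀ y ∈ Fl, y ∈ Fk → φ y = y := fun y h h' => by
      rw [← hφ, pow_eq_self_of_mem_of_mem hkl.symm hFl hFk h h']
    have hls : ∀ y ∈ Fl, y ∈ Fs → φ y = y := fun y h h' => by
      rw [← hφ, pow_eq_self_of_mem_of_mem hls hFl hFs h h']
    have hks : ∀ y ∈ Fk, y ∈ Fs → φ y = y := fun y h h' => by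
      rw [← hφ, pow_eq_self_of_mem_of_mem hks hFk hFs h h']
    have scale : ∀ {m a u e b v f}, φ m = m → P b v f ≠ 0 → b = m * a → v = m * u → f = m * e →
        Submodule.span F {P b v f} = Submodule.span F {P a u e} := by
      rintro m a u e b v f hm h0 rfl rfl rfl
      exact span_singleton_mul_eq F (hfix hm) h0 (hPmul hm a u e)
    rcases linearForms_unique (hne hp) h1 h2 h3 h12 h13 h23 with
      ⟨r, k1, k2, k3, k4, k5, k6⟩ | ⟨r, k1, k2, k3, k4, k5, k6⟩
    · rcases exists_fixed_scalar φ Fl Fk Fs hlk hls hks ha hb hc hd hu hv hw hx he hf hg hh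
        (hne hp) (hne ht) H1 H2 H3 k1 k2 k3 k4 k5 k6 with
        hm | ⟨m, hm, m1, m2, m3, m4, m5, m6⟩
      · rw [scale hm hs' k1 k2 k3, scale hm hr k4 k5 k6]
      · rw [scale hm ht m1 m2 m3, scale hm hr m4 m5 m6, Set.pair_comm]
    · rcases exists_fixed_scalar φ Fl Fk Fs hlk hls hks ha hb hd hc hu hv hx hw he hf hh hg
        (hne hp) (hne hs') (by rw [H1]; ring) (by rw [H2]; ring) (by rw [H3]; ring)
        k1 k2 k3 k4 k5 k6 with
        hm | ⟨m, hm, m1, m2, m3, m4, m5, m6⟩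
      · rw [scale hm ht k1 k2 k3, scale hm hr k4 k5 k6, Set.pair_comm]
      · rw [scale hm hs' m1 m2 m3, scale hm hr m4 m5 m6]
  · have hinj : ∀ a ∈ Fl, ∀ u ∈ Fk, ∀ e ∈ Fs, P a u e = 0 → a = 0 ∧ u = 0 ∧ e = 0 := by
      intro a ha u hu e he h
      have h0 := coeff_eq_zero_of_sum_pow_eq_zero Fkls γ
        (show 7 ≤ (minpoly Fkls γ).natDegree by omega)
        ![δ₁ * a, δ₂ * φ a, 0, τ₁ * u, τ₂ * φ u, η₁ * e, η₂ * φ e]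
        (by
          have hφ' := hφL Fkls
          have ha' := hFlFkls ha
          have hu' := hFkFkls hu
          have he' := hFsFkls he
          intro i
          fin_cases i
          exacts [mul_mem (hFlFkls hδ₁) ha', mul_mem (hFlFkls hδ₂) (hφ' _ ha'), zero_mem _,
            mul_mem (hFkFkls hτ₁) hu', mul_mem (hFkFkls hτ₂) (hφ' _ hu'),
            mul_mem (hFsFkls hη₁) he', mul_mem (hFsFkls hη₂) (hφ' _ he')])
        (by
          simp only [Fin.sum_univ_succ, Fin.sum_univ_zero, Matrix.cons_val_zero,
            Matrix.cons_val_succ, Fin.val_zero, Fin.val_succ]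
          linear_combination h)
      exact ⟨by simpa [hδ₁0] using h0 0, by simpa [hτ₁0] using h0 3, by simpa [hη₁0] using h0 5⟩
    let T : Fl × Fk × Fs → V := fun y =>
      ⟨P y.1 y.2.1 y.2.2, y.1, y.1.2, y.2.1, y.2.1.2, y.2.2, y.2.2.2, rfl⟩
    have hT : Function.Bijective T := by
      constructor
      · rintro ⟨⟨a, ha⟩, ⟨u, hu⟩, ⟨e, he⟩⟩ ⟨⟨b, hb⟩, ⟨v, hv⟩, ⟨f, hf⟩⟩ h
        have h' : P a u e = P b v f := congrArg Subtype.val h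
        obtain ⟨h1, h2, h3⟩ := hinj (a - b) (sub_mem ha hb) (u - v) (sub_mem hu hv) (e - f)
          (sub_mem he hf) (by
            simp only [P, map_sub] at h' ⊢
            linear_combination h')
        simp [sub_eq_zero.1 h1, sub_eq_zero.1 h2, sub_eq_zero.1 h3]
      · rintro ⟨_, a, ha, u, hu, e, he, rfl⟩
        exact ⟨(⟨a, ha⟩, ⟨u, hu⟩, ⟨e, he⟩), rfl⟩
    have hcard := Nat.card_eq_of_bijective T hT
    rw [Nat.card_prod, Nat.card_prod, hFl, hFk, hFs, Module.natCard_eq_pow_finrank (K := F), hF,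
      ← pow_add, ← pow_add] at hcard
    have := Nat.pow_right_injective hq1 hcard
    omega
end
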